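/- arXiv:1706.07653 — 4 statements merged into one kernel-verified Lean document; each statement's English description precedes it below -/
import Mathlib

section
/- For all a, y > 0 the limit ψ^S(a,y) := lim_{n→∞} (1/(2n)) log P^S_{2n}(a,y) exists, and ψ^S(a,y) = ψ^C(a,y), i.e. ψ^S(a,y) = log 2 if a ≤ 2 and y ≤ 1; ψ^S(a,y) = (1/2)log 2 + (1/2)log a − (1/4)log(a−1) if a > 2 and y ≤ 1; ψ^S(a,y) = log(y+1) − (1/2)log y if y > 1 and a ≤ y + 1; and ψ^S(a,y) = (1/2)log a − (1/4)log(a−1) + (1/2)log(y+1) − (1/4)log y if y > 1 and a > y + 1. -/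
open Finset Filter

attribute [local instance] Classical.propDecidable

/-- Height (second coordinate) of a binomial path after `i` steps, starting at height `c`;
steps are encoded by `s : Fin n → Bool` (`true` = up step `(1,1)`, `false` = down step `(1,-1)`).
The path visits the points `(x₀ + i, hgt c s i)` for `0 ≤ i ≤ n`. -/
def hgt {n : ℕ} (c : ℤ) (s : Fin n → Bool) (i : ℕ) : ℤ :=
  c + ∑ j ∈ Finset.range i, (if h : j < n then (if s ⟨j, h⟩ then (1 : ℤ) else -1) else 0)

/-- The path lies in the upper half-plane (all second coordinates ≥ 0). -/
def InUHP {n : ℕ} (c : ℤ) (s : Fin n → Bool) : Prop :=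
  ∀ i ≤ n, 0 ≤ hgt c s i

/-- The number of vertices of the path with second coordinate 0. -/
def visits {n : ℕ} (c : ℤ) (s : Fin n → Bool) : ℕ :=
  ((Finset.range (n + 1)).filter (fun i => hgt c s i = 0)).card

/-- `(c, sp, sm)` encodes a staircase polygon of length `2n` in `𝒫^S_{2n}`:
both binomial paths of length `n` start at `(0, c)` (so the leftmost vertex has first
coordinate `0`), they end at the same point, the upper path `sp` is strictly above the
lower path `sm` at the intermediate points, the polygon lies in the upper half-plane,
and it has at least one vertex with second coordinate `0`. -/
def IsStaircase {n : ℕ} (c : ℤ) (sp sm : Fin n → Bool) : Prop :=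
  hgt c sp n = hgt c sm n ∧
  (∀ i, 0 < i → i < n → hgt c sm i < hgt c sp i) ∧
  InUHP c sp ∧ InUHP c sm ∧
  (∃ i ≤ n, hgt c sp i = 0 ∨ hgt c sm i = 0)

/-- `P^S_{2n}(a,y)`: partition function of half-space staircase polygons of length `2n`,
with weight `a` per vertex with second coordinate `0` (all such vertices lie on the lower
path, since interior vertices of the upper path are strictly above the lower path) and
weight `y` per unit of height `h(π)` (the second coordinate of `π⁺_{⌊n/2⌋}`). -/
noncomputable def PS (n : ℕ) (a y : ℝ) : ℝ :=
  ∑ p ∈ (Finset.univ : Finset (Fin (n + 1) × (Fin n → Bool) × (Fin n → Bool))).filter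
      (fun p => IsStaircase ((p.1 : ℕ) : ℤ) p.2.1 p.2.2),
    a ^ visits ((p.1 : ℕ) : ℤ) p.2.2 * y ^ hgt ((p.1 : ℕ) : ℤ) p.2.1 (n / 2)


/-- The sign of a step. -/
def eps (b : Bool) : ℤ := if b then 1 else -1

lemma eps_true : eps true = 1 := rfl
lemma eps_false : eps false = -1 := rfl
lemma eps_not (b : Bool) : eps (!b) = - eps b := by cases b <;> rfl
lemma eps_le (b : Bool) : eps b ≤ 1 := by cases b <;> decide
lemma le_eps (b : Bool) : -1 ≤ eps b := by cases b <;> decide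
lemma eps_inj {b b' : Bool} (h : eps b = eps b') : b = b' := by
  cases b <;> cases b' <;> simp_all [eps]

lemma hgt_zero {n : ℕ} (c : ℤ) (s : Fin n → Bool) : hgt c s 0 = c := by simp [hgt]

lemma hgt_succ {n : ℕ} (c : ℤ) (s : Fin n → Bool) (t : ℕ) (h : t < n) :
    hgt c s (t + 1) = hgt c s t + eps (s ⟨t, h⟩) := by
  simp only [hgt, Finset.sum_range_succ, h, dif_pos, eps]
  ring

lemma hgt_cons {n : ℕ} (c : ℤ) (b : Bool) (s : Fin n → Bool) (t : ℕ) :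
    hgt c (Fin.cons b s : Fin (n + 1) → Bool) (t + 1) = hgt (c + eps b) s t := by
  simp only [hgt, Finset.sum_range_succ']
  have h0 : (if h : 0 < n + 1 then
      (if (Fin.cons b s : Fin (n + 1) → Bool) ⟨0, h⟩ then (1 : ℤ) else -1) else 0) = eps b := by
    simp [eps]
  rw [h0]
  have : ∀ j, (if h : j + 1 < n + 1 then
      (if (Fin.cons b s : Fin (n + 1) → Bool) ⟨j + 1, h⟩ then (1 : ℤ) else -1) else 0)
      = (if h : j < n then (if s ⟨j, h⟩ then (1 : ℤ) else -1) else 0) := by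
    intro j
    by_cases hj : j < n
    · have hj' : j + 1 < n + 1 := by omega
      simp only [hj, hj', dif_pos]
      have : (Fin.cons b s : Fin (n + 1) → Bool) ⟨j + 1, hj'⟩ = s ⟨j, hj⟩ :=
        Fin.cons_succ (α := fun _ => Bool) b s ⟨j, hj⟩
      rw [this]
    · have hj' : ¬ (j + 1 < n + 1) := by omega
      simp only [hj, hj', dif_neg, not_false_iff]
  simp only [this]
  ring

lemma hgt_diff_le {n : ℕ} (c : ℤ) (s : Fin n → Bool) (t : ℕ) (ht : t ≤ n) :
    hgt c s t ≤ c + t ∧ c - t ≤ hgt c s t := by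
  induction t with
  | zero => simp [hgt_zero]
  | succ t ih =>
    rw [hgt_succ c s t ht]
    have := ih (by omega)
    have := eps_le (s ⟨t, ht⟩)
    have := le_eps (s ⟨t, ht⟩)
    push_cast
    omega

lemma hgt_shift {n : ℕ} (c : ℤ) (s : Fin n → Bool) (t : ℕ) : hgt c s t = c + hgt 0 s t := by
  simp [hgt]

lemma sum_cons {n : ℕ} (f : (Fin (n + 1) → Bool) → ℝ) :
    ∑ s, f s = ∑ s : Fin n → Bool, f (Fin.cons true s) + ∑ s : Fin n → Bool, f (Fin.cons false s) := by
  rw [← (Fin.consEquiv (fun _ : Fin (n + 1) => Bool)).sum_comp, Fintype.sum_prod_type,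
    Fintype.sum_bool]
  rfl

/-- Transfer recursion for a pair of walkers. -/
noncomputable def Zw (φ G : ℤ → ℤ → ℝ) : ℕ → ℤ → ℤ → ℝ
  | 0, i, j => φ i j * G i j
  | k + 1, i, j => φ i j * (Zw φ G k (i + 1) (j + 1) + Zw φ G k (i + 1) (j - 1)
      + Zw φ G k (i - 1) (j + 1) + Zw φ G k (i - 1) (j - 1))

lemma Zw_eq (φ G : ℤ → ℤ → ℝ) (k : ℕ) : ∀ i j : ℤ,
    Zw φ G k i j = ∑ sp : Fin k → Bool, ∑ sm : Fin k → Bool,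
      (∏ t ∈ range (k + 1), φ (hgt i sp t) (hgt j sm t)) * G (hgt i sp k) (hgt j sm k) := by
  induction k with
  | zero => intro i j; simp [Zw, hgt_zero]
  | succ k ih =>
    intro i j
    rw [sum_cons]
    simp only [sum_cons (n := k)]
    simp only [Finset.prod_range_succ' _ (k + 1), hgt_cons, hgt_zero, Zw, ih, eps_true, eps_false,
      ← sub_eq_add_neg, Finset.sum_add_distrib, mul_add, Finset.mul_sum]
    have e : ∀ x y z : ℝ, x * y * z = y * (x * z) := by intros; ring
    simp only [e]
    ring

lemma Zw_lower (φ G F : ℤ → ℤ → ℝ) (μ : ℝ) (hφ : ∀ i j, 0 ≤ φ i j) (hμ : 0 ≤ μ)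
    (h0 : ∀ i j, F i j ≤ φ i j * G i j)
    (h1 : ∀ i j, μ * F i j ≤ φ i j * (F (i + 1) (j + 1) + F (i + 1) (j - 1)
      + F (i - 1) (j + 1) + F (i - 1) (j - 1))) (k : ℕ) :
    ∀ i j, μ ^ k * F i j ≤ Zw φ G k i j := by
  induction k with
  | zero => intro i j; simpa [Zw] using h0 i j
  | succ k ih =>
    intro i j
    have := mul_le_mul_of_nonneg_left (h1 i j) (pow_nonneg hμ k)
    calc μ ^ (k + 1) * F i j = μ ^ k * (μ * F i j) := by ring
      _ ≤ _ := this
      _ = φ i j * (μ ^ k * F (i + 1) (j + 1) + μ ^ k * F (i + 1) (j - 1)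
          + μ ^ k * F (i - 1) (j + 1) + μ ^ k * F (i - 1) (j - 1)) := by ring
      _ ≤ _ := by
        rw [Zw]
        apply mul_le_mul_of_nonneg_left _ (hφ i j)
        gcongr <;> apply ih

lemma sum_le_of_inj {α β : Type*} (s : Finset α) (t : Finset β) (f : α → ℝ) (g : β → ℝ)
    (e : α → β) (he : ∀ x ∈ s, e x ∈ t) (inj : Set.InjOn e s) (h : ∀ x ∈ s, f x ≤ g (e x))
    (hg : ∀ x ∈ t, 0 ≤ g x) : ∑ x ∈ s, f x ≤ ∑ x ∈ t, g x := by
  calc ∑ x ∈ s, f x ≤ ∑ x ∈ s, g (e x) := Finset.sum_le_sum h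
    _ = ∑ x ∈ s.image e, g x := (Finset.sum_image inj).symm
    _ ≤ _ := Finset.sum_le_sum_of_subset_of_nonneg
        (by intro x hx; rw [Finset.mem_image] at hx; obtain ⟨z, hz, rfl⟩ := hx; exact he z hz)
        (fun x hx _ => hg x hx)

lemma visits_cons {n : ℕ} (c : ℤ) (b : Bool) (s : Fin n → Bool) :
    visits c (Fin.cons b s : Fin (n + 1) → Bool)
      = visits (c + eps b) s + (if c = 0 then 1 else 0) := by
  simp only [visits, Finset.card_filter]
  rw [Finset.sum_range_succ']
  simp only [hgt_cons, hgt_zero]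

/-- Half polygons. -/
def IsHalf {m : ℕ} (c : ℤ) (sp sm : Fin m → Bool) : Prop :=
  (∀ t, 0 < t → t ≤ m → hgt c sm t < hgt c sp t) ∧ InUHP c sm ∧ ∃ t ≤ m, hgt c sm t = 0

/-- The set of half polygons. -/
noncomputable def Hset (m : ℕ) : Finset (Fin (m + 1) × (Fin m → Bool) × (Fin m → Bool)) :=
  Finset.univ.filter (fun X => IsHalf ((X.1 : ℕ) : ℤ) X.2.1 X.2.2)

/-- Weight of a half polygon. -/
noncomputable def Hw (m : ℕ) (a p : ℝ) (X : Fin (m + 1) × (Fin m → Bool) × (Fin m → Bool)) : ℝ :=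
  a ^ visits ((X.1 : ℕ) : ℤ) X.2.2 * p ^ hgt ((X.1 : ℕ) : ℤ) X.2.1 m

/-- Partition function of half polygons. -/
noncomputable def Rh (m : ℕ) (a p : ℝ) : ℝ := ∑ X ∈ Hset m, Hw m a p X

lemma Hw_nonneg {m : ℕ} {a p : ℝ} (ha : 0 ≤ a) (hp : 0 ≤ p) (X) : 0 ≤ Hw m a p X :=
  mul_nonneg (pow_nonneg ha _) (zpow_nonneg hp _)

lemma exists_base {m : ℕ} (s : Fin m → Bool) :
    ∃ c : Fin (m + 1), InUHP ((c : ℕ) : ℤ) s ∧ ∃ t ≤ m, hgt ((c : ℕ) : ℤ) s t = 0 := by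
  obtain ⟨t, ht, hmin⟩ := Finset.exists_min_image (range (m + 1)) (hgt 0 s) ⟨0, by simp⟩
  rw [Finset.mem_range] at ht
  have h0 := hmin 0 (by simp)
  rw [hgt_zero] at h0
  have h1 := (hgt_diff_le 0 s t (by omega)).2
  refine ⟨⟨(-(hgt 0 s t)).toNat, by omega⟩, ?_, t, by omega, ?_⟩
  · intro i hi
    have := hmin i (by simp; omega)
    rw [hgt_shift]
    simp only
    omega
  · rw [hgt_shift]
    simp only
    omega

lemma half_pulled_weight {k : ℕ} (p : ℝ) (i j : ℤ) (sp sm : Fin k → Bool) :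
    (∏ t ∈ range (k + 1), (if hgt j sm t < hgt i sp t then (1 : ℝ) else 0)) * p
      = if (∀ t ∈ range (k + 1), hgt j sm t < hgt i sp t) then p else 0 := by
  rw [Finset.prod_ite_zero]
  simp

lemma Rh_pulled (k : ℕ) (a p : ℝ) (ha : 1 ≤ a) (hp : 1 < p) :
    ((p + p⁻¹) ^ 2) ^ k * (p ^ (2 : ℤ) - p ^ (-2 : ℤ)) ≤ Rh (k + 1) a p := by
  have hp0 : 0 < p := by linarith
  have key := Zw_lower (fun i j => if j < i then 1 else 0) (fun i j => p ^ (i - j))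
    (fun i j => if j < i ∧ Even (i - j) then p ^ (i - j) - p ^ (-(i - j)) else 0)
    ((p + p⁻¹) ^ 2) (by intro i j; split_ifs <;> norm_num) (by positivity)
    (by
      intro i j
      try dsimp only
      have : 0 < p ^ (-(i - j)) := by positivity
      have : 0 < p ^ (i - j) := by positivity
      split_ifs with h1 h2
      · linarith
      · exact absurd h1.1 h2
      · linarith
      · linarith)
    (by
      intro i j
      try dsimp only
      by_cases h : j < i ∧ Even (i - j)
      · obtain ⟨hij, he⟩ := h
        have he' := he
        obtain ⟨r, hr⟩ := he'
        have a1 : i + 1 - (j + 1) = i - j := by ring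
        have a2 : i + 1 - (j - 1) = i - j + 2 := by ring
        have a3 : i - 1 - (j + 1) = i - j - 2 := by ring
        have a4 : i - 1 - (j - 1) = i - j := by ring
        have e2 : Even (i - j + 2) := ⟨r + 1, by omega⟩
        have e3 : Even (i - j - 2) := ⟨r - 1, by omega⟩
        have l1 : j + 1 < i + 1 := by omega
        have l2 : j - 1 < i + 1 := by omega
        have l4 : j - 1 < i - 1 := by omega
        have F3 : (if j + 1 < i - 1 ∧ Even (i - 1 - (j + 1)) then
            p ^ (i - 1 - (j + 1)) - p ^ (-(i - 1 - (j + 1))) else 0)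
            = p ^ (i - j - 2) - p ^ (-(i - j - 2)) := by
          rw [a3]
          by_cases h : j + 1 < i - 1
          · simp [h, e3]
          · have : i - j - 2 = 0 := by omega
            simp [h, this]
        rw [F3]
        simp only [a1, a2, a4, hij, he, e2, l1, l2, l4, and_self, if_true]
        have q1 : p ^ (i - j + 2) = p ^ (i - j) * p ^ 2 := by
          rw [zpow_add₀ hp0.ne']; norm_cast
        have q2 : p ^ (i - j - 2) = p ^ (i - j) * (p⁻¹) ^ 2 := by
          rw [zpow_sub₀ hp0.ne', inv_pow]; norm_cast
        have q3 : p ^ (-(i - j + 2)) = p ^ (-(i - j)) * (p⁻¹) ^ 2 := by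
          rw [neg_add, ← sub_eq_add_neg, zpow_sub₀ hp0.ne', inv_pow]; norm_cast
        have q4 : p ^ (-(i - j - 2)) = p ^ (-(i - j)) * p ^ 2 := by
          rw [neg_sub', sub_neg_eq_add, zpow_add₀ hp0.ne']; norm_cast
        rw [q1, q2, q3, q4]
        have : p * p⁻¹ = 1 := mul_inv_cancel₀ hp0.ne'
        apply le_of_eq
        linear_combination 2 * (p ^ (i - j) - p ^ (-(i - j))) * this
      · rw [if_neg h, mul_zero]
        apply mul_nonneg
        · split_ifs <;> norm_num
        · have : ∀ d : ℤ, 0 ≤ d → 0 ≤ p ^ d - p ^ (-d) := by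
            intro d hd
            have : p ^ (-d) ≤ p ^ d := zpow_le_zpow_right₀ hp.le (by omega)
            linarith
          have : ∀ i j : ℤ, 0 ≤ if j < i ∧ Even (i - j) then p ^ (i - j) - p ^ (-(i - j)) else 0 := by
            intro i j
            split_ifs with h
            · exact this _ (by omega)
            · rfl
          have h1 := this (i + 1) (j + 1)
          have h2 := this (i + 1) (j - 1)
          have h3 := this (i - 1) (j + 1)
          have h4 := this (i - 1) (j - 1)
          linarith)
    k 1 (-1)
  have hs : (fun i j : ℤ => if j < i ∧ Even (i - j) then p ^ (i - j) - p ^ (-(i - j)) else 0) 1 (-1)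
      = p ^ (2 : ℤ) - p ^ (-2 : ℤ) := by
    have : Even (2 : ℤ) := by decide
    simp [this]
  dsimp only at hs; rw [hs] at key
  refine key.trans ?_
  rw [Zw_eq]
  simp only [half_pulled_weight]
  refine le_trans (b := ∑ x ∈ (Finset.univ : Finset ((Fin k → Bool) × (Fin k → Bool))).filter
      (fun x => ∀ t ∈ range (k + 1), hgt (-1) x.2 t < hgt 1 x.1 t),
      p ^ (hgt 1 x.1 k - hgt (-1) x.2 k)) (le_of_eq ?_) ?_
  · rw [Finset.sum_filter, Fintype.sum_prod_type]
  choose cf hcf using (fun s : Fin (k + 1) → Bool => exists_base s)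
  refine sum_le_of_inj _ _ _ _
    (fun x => (cf (Fin.cons false x.2), Fin.cons true x.1, Fin.cons false x.2)) ?_ ?_ ?_ ?_
  · intro x hx
    simp only [Finset.mem_filter, Finset.mem_univ, true_and, Finset.mem_range] at hx
    simp only [Hset, Finset.mem_filter, Finset.mem_univ, true_and]
    refine ⟨?_, (hcf _).1, (hcf _).2⟩
    intro t ht ht'
    obtain ⟨t, rfl⟩ : ∃ u, t = u + 1 := ⟨t - 1, by omega⟩
    rw [hgt_cons, hgt_cons, eps_true, eps_false]
    have := hx t (by omega)
    rw [hgt_shift 1, hgt_shift (-1)] at this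
    rw [hgt_shift (_ + 1), hgt_shift (_ + -1)]
    omega
  · intro x _ z _ h
    simp only [Prod.mk.injEq, Fin.cons_inj, true_and] at h
    ext1
    · exact h.2.1
    · exact h.2.2
  · intro x hx
    simp only [Hw]
    have hU := (hcf (Fin.cons false x.2)).1 (k + 1) le_rfl
    rw [hgt_cons, eps_false, hgt_shift] at hU
    rw [hgt_cons, eps_true]
    have h1 : p ^ (hgt 1 x.1 k - hgt (-1) x.2 k)
        ≤ p ^ (hgt (((cf (Fin.cons false x.2) : ℕ) : ℤ) + 1) x.1 k) := by
      apply zpow_le_zpow_right₀ hp.le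
      rw [hgt_shift 1, hgt_shift (-1), hgt_shift (_ + 1)]
      omega
    have h2 : 1 ≤ a ^ visits ((cf (Fin.cons false x.2) : ℕ) : ℤ) (Fin.cons false x.2 : Fin (k + 1) → Bool) :=
      one_le_pow₀ ha
    have h3 : 0 ≤ p ^ (hgt (((cf (Fin.cons false x.2) : ℕ) : ℤ) + 1) x.1 k) := by positivity
    nlinarith
  · intro x _
    exact Hw_nonneg (by linarith) hp0.le _

lemma half_ads_weight {k : ℕ} (a p : ℝ) (i j : ℤ) (sp sm : Fin k → Bool) :
    (∏ t ∈ range (k + 1), (if hgt j sm t < hgt i sp t ∧ 0 ≤ hgt j sm t then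
        (if hgt j sm t = 0 then a else 1) else 0)) * p
      = if (∀ t ∈ range (k + 1), hgt j sm t < hgt i sp t ∧ 0 ≤ hgt j sm t) then
        a ^ visits j sm * p else 0 := by
  rw [Finset.prod_ite_zero, visits, Finset.prod_ite, Finset.prod_const, Finset.prod_const_one,
    mul_one, ite_mul, zero_mul]

/-- Determinantal function for two walkers. -/
noncomputable def detF (f g : ℤ → ℝ) (i j : ℤ) : ℝ :=
  if j < i ∧ 0 ≤ j ∧ Even (i - j) then max (g i * f j - f i * g j) 0 else 0

lemma detF_nonneg (f g : ℤ → ℝ) (i j : ℤ) : 0 ≤ detF f g i j := by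
  unfold detF; split_ifs
  · exact le_max_right _ _
  · exact le_rfl

lemma le_detF (f g : ℤ → ℝ) (i j : ℤ) (h : j ≤ i) (h0 : 0 ≤ j) (he : Even (i - j)) :
    g i * f j - f i * g j ≤ detF f g i j := by
  unfold detF
  by_cases hij : j < i
  · rw [if_pos ⟨hij, h0, he⟩]; exact le_max_left _ _
  · have : i = j := by omega
    subst this
    rw [if_neg (by simp)]
    apply le_of_eq; ring

lemma detF_step (f g : ℤ → ℝ) (a l1 l2 : ℝ) (ha : 0 < a) (hl : 0 ≤ l1 * l2)
    (hf : ∀ i, f (i + 1) + f (i - 1) = l1 * f i) (hg : ∀ i, g (i + 1) + g (i - 1) = l2 * g i)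
    (hf0 : a * f 1 = l1 * f 0) (hg0 : a * g 1 = l2 * g 0) (i j : ℤ) :
    (l1 * l2) * detF f g i j ≤ (if j < i ∧ 0 ≤ j then (if j = 0 then a else 1) else 0) *
      (detF f g (i + 1) (j + 1) + detF f g (i + 1) (j - 1)
      + detF f g (i - 1) (j + 1) + detF f g (i - 1) (j - 1)) := by
  have n1 := detF_nonneg f g (i + 1) (j + 1)
  have n2 := detF_nonneg f g (i + 1) (j - 1)
  have n3 := detF_nonneg f g (i - 1) (j + 1)
  have n4 := detF_nonneg f g (i - 1) (j - 1)
  have hφ : 0 ≤ (if j < i ∧ 0 ≤ j then (if j = 0 then a else 1) else 0) := by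
    split_ifs <;> linarith
  have hR := mul_nonneg hφ (add_nonneg (add_nonneg (add_nonneg n1 n2) n3) n4)
  by_cases h : j < i ∧ 0 ≤ j ∧ Even (i - j)
  · by_cases hX : g i * f j - f i * g j ≤ 0
    · have : detF f g i j = 0 := by
        unfold detF; rw [if_pos h]; exact max_eq_right hX
      rw [this, mul_zero]; exact hR
    · have hD : detF f g i j = g i * f j - f i * g j := by
        unfold detF; rw [if_pos h]; exact max_eq_left (le_of_not_ge hX)
      obtain ⟨hij, hj, he⟩ := h
      obtain ⟨r, hr⟩ := he
      have m1 := le_detF f g (i + 1) (j + 1) (by omega) (by omega) ⟨r, by omega⟩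
      have m3 := le_detF f g (i - 1) (j + 1) (by omega) (by omega) ⟨r - 1, by omega⟩
      rw [hD, if_pos ⟨hij, hj⟩]
      by_cases hj0 : j = 0
      · subst hj0
        rw [if_pos rfl]
        rw [zero_add] at *
        have : (l1 * l2) * (g i * f 0 - f i * g 0)
            = a * ((g (i + 1) * f 1 - f (i + 1) * g 1) + (g (i - 1) * f 1 - f (i - 1) * g 1)) := by
          linear_combination (-a * f 1) * hg i + (a * g 1) * hf i - (l2 * g i) * hf0
            + (l1 * f i) * hg0
        rw [this]
        apply mul_le_mul_of_nonneg_left _ ha.le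
        linarith
      · rw [if_neg hj0, one_mul]
        have m2 := le_detF f g (i + 1) (j - 1) (by omega) (by omega) ⟨r + 1, by omega⟩
        have m4 := le_detF f g (i - 1) (j - 1) (by omega) (by omega) ⟨r, by omega⟩
        have : (l1 * l2) * (g i * f j - f i * g j)
            = (g (i + 1) * f (j + 1) - f (i + 1) * g (j + 1))
            + (g (i + 1) * f (j - 1) - f (i + 1) * g (j - 1))
            + (g (i - 1) * f (j + 1) - f (i - 1) * g (j + 1))
            + (g (i - 1) * f (j - 1) - f (i - 1) * g (j - 1)) := by
          linear_combination (-(f (j + 1) + f (j - 1))) * hg i - (l2 * g i) * hf j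
            + (g (j + 1) + g (j - 1)) * hf i + (l1 * f i) * hg j
        rw [this]
        linarith
  · have : detF f g i j = 0 := by unfold detF; rw [if_neg h]
    rw [this, mul_zero]; exact hR

lemma Rh_ads (k : ℕ) (f g : ℤ → ℝ) (a p l1 l2 K : ℝ) (ha : 1 ≤ a) (hp : 0 < p)
    (hl : 0 ≤ l1 * l2) (hK : 0 < K)
    (hf : ∀ i, f (i + 1) + f (i - 1) = l1 * f i) (hg : ∀ i, g (i + 1) + g (i - 1) = l2 * g i)
    (hf0 : a * f 1 = l1 * f 0) (hg0 : a * g 1 = l2 * g 0)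
    (hb : ∀ i j, 0 ≤ j → j < i → g i * f j - f i * g j ≤ K * p ^ i) :
    (l1 * l2) ^ k * (g 2 * f 0 - f 2 * g 0) ≤ K * Rh (k + 1) a p := by
  have key := Zw_lower
    (fun i j => if j < i ∧ 0 ≤ j then (if j = 0 then a else 1) else 0) (fun i j => K * p ^ i)
    (detF f g) (l1 * l2) (by intro i j; split_ifs <;> linarith) hl
    (by
      intro i j
      have hKp : 0 < K * p ^ i := by positivity
      by_cases h : j < i ∧ 0 ≤ j ∧ Even (i - j)
      · rw [if_pos ⟨h.1, h.2.1⟩]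
        unfold detF
        rw [if_pos h]
        have h1 : max (g i * f j - f i * g j) 0 ≤ K * p ^ i :=
          max_le (hb i j h.2.1 h.1) hKp.le
        split_ifs <;> nlinarith
      · unfold detF
        rw [if_neg h]
        apply mul_nonneg _ hKp.le
        split_ifs <;> linarith)
    (detF_step f g a l1 l2 (by linarith) hl hf hg hf0 hg0) k 2 0
  have h20 := le_detF f g 2 0 (by norm_num) le_rfl (by decide)
  refine (mul_le_mul_of_nonneg_left h20 (pow_nonneg hl k)).trans (key.trans ?_)
  rw [Zw_eq]
  simp only [half_ads_weight]
  refine le_trans (b := ∑ x ∈ (Finset.univ : Finset ((Fin k → Bool) × (Fin k → Bool))).filter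
      (fun x => ∀ t ∈ range (k + 1), hgt 0 x.2 t < hgt 2 x.1 t ∧ 0 ≤ hgt 0 x.2 t),
      a ^ visits 0 x.2 * (K * p ^ (hgt 2 x.1 k))) (le_of_eq ?_) ?_
  · rw [Finset.sum_filter, Fintype.sum_prod_type]
    refine Finset.sum_congr rfl (fun _ _ => Finset.sum_congr rfl (fun _ _ => ?_))
    congr
  rw [Rh, Finset.mul_sum]
  have c1 : (((⟨1, by omega⟩ : Fin (k + 1 + 1)) : ℕ) : ℤ) = 1 := by simp
  refine sum_le_of_inj _ _ _ _
    (fun x => (⟨1, by omega⟩, Fin.cons true x.1, Fin.cons false x.2)) ?_ ?_ ?_ ?_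
  · intro x hx
    simp only [Finset.mem_filter, Finset.mem_univ, true_and, Finset.mem_range] at hx
    simp only [Hset, Finset.mem_filter, Finset.mem_univ, true_and]
    rw [c1]
    refine ⟨?_, ?_, 1, by omega, ?_⟩
    · intro t ht ht'
      obtain ⟨t, rfl⟩ : ∃ u, t = u + 1 := ⟨t - 1, by omega⟩
      rw [hgt_cons, hgt_cons, eps_true, eps_false]
      exact (hx t (by omega)).1
    · intro t ht
      cases t with
      | zero => rw [hgt_zero]; norm_num
      | succ t =>
        rw [hgt_cons, eps_false]
        exact (hx t (by omega)).2
    · rw [hgt_cons 1 false _ 0, hgt_zero, eps_false]; rfl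
  · intro x _ z _ h
    simp only [Prod.mk.injEq, Fin.cons_inj, true_and] at h
    ext1
    · exact h.1
    · exact h.2
  · intro x hx
    simp only [Hw]
    rw [c1, visits_cons, hgt_cons, eps_true, eps_false]
    apply le_of_eq
    norm_num
    ring
  · intro x _
    exact mul_nonneg hK.le (Hw_nonneg (by linarith) hp.le _)

lemma zpow_eig (p : ℝ) (hp : p ≠ 0) (i : ℤ) :
    p ^ (i + 1) + p ^ (i - 1) = (p + p⁻¹) * p ^ i := by
  rw [zpow_add₀ hp, zpow_sub₀ hp, zpow_one]
  field_simp

lemma Rh_adsorbed (p q : ℝ) (hp : 1 < p) (hpq : p < q) :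
    ∃ C > 0, ∀ k, ((p + p⁻¹) * (q + q⁻¹)) ^ k ≤ C * Rh (k + 1) (q ^ 2 + 1) p := by
  have hp0 : 0 < p := by linarith
  have hq0 : 0 < q := by linarith
  set f : ℤ → ℝ := fun i => (q⁻¹) ^ i with hf
  set g : ℤ → ℝ := fun i => (q ^ 2 - p ^ 2) * p ^ i - (q ^ 2 * p ^ 2 - 1) * (p⁻¹) ^ i with hg
  have hα : 0 < q ^ 2 - p ^ 2 := by nlinarith
  have hp1 : 1 < p ^ 2 := by nlinarith
  have hq1 : 1 < q ^ 2 := by nlinarith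
  have hβ : 0 < q ^ 2 * p ^ 2 - 1 := by nlinarith
  set K := 2 * ((q ^ 2 - p ^ 2) + (q ^ 2 * p ^ 2 - 1)) with hK
  have hD : g 2 * f 0 - f 2 * g 0 = (p ^ 2 - 1) * (q ^ 2 - p ^ 2) * (1 - 1 / (p ^ 2 * q ^ 2)) := by
    simp only [hf, hg]
    have : ∀ x : ℝ, x ^ (2 : ℤ) = x ^ 2 := by intro x; norm_cast
    simp only [this, zpow_zero]
    field_simp
    ring
  have hDpos : 0 < g 2 * f 0 - f 2 * g 0 := by
    rw [hD]
    have : 1 / (p ^ 2 * q ^ 2) < 1 := by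
      rw [div_lt_one (by positivity)]; nlinarith
    have h1 : 0 < 1 - 1 / (p ^ 2 * q ^ 2) := by linarith
    have h2 : 0 < p ^ 2 - 1 := by linarith
    positivity
  refine ⟨K / (g 2 * f 0 - f 2 * g 0), by positivity, ?_⟩
  intro k
  have := Rh_ads k f g (q ^ 2 + 1) p (q + q⁻¹) (p + p⁻¹) K (by linarith) hp0 (by positivity)
    (by positivity)
    (by intro i
        have := zpow_eig q⁻¹ (by positivity) i
        rw [inv_inv, add_comm q⁻¹] at this
        exact this)
    (by intro i
        have h1 := zpow_eig p⁻¹ (by positivity) i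
        have h2 := zpow_eig p (by positivity) i
        rw [inv_inv, add_comm p⁻¹] at h1
        simp only [hg]
        linear_combination (q ^ 2 - p ^ 2) * h2 - (q ^ 2 * p ^ 2 - 1) * h1)
    (by simp only [hf, zpow_one, zpow_zero]; field_simp)
    (by simp only [hg, zpow_one, zpow_zero]; field_simp; ring)
    (by
      intro i j hj hij
      have hpi : 0 < p ^ i := by positivity
      have gb : ∀ i : ℤ, 0 ≤ i → |g i| ≤ ((q ^ 2 - p ^ 2) + (q ^ 2 * p ^ 2 - 1)) * p ^ i := by
        intro i hi
        have h1 : 1 ≤ p ^ i := one_le_zpow₀ hp.le hi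
        have h2 : (p⁻¹) ^ i ≤ 1 := by
          rw [inv_zpow]; exact inv_le_one_of_one_le₀ h1
        have h3 : 0 < (p⁻¹) ^ i := by positivity
        rw [abs_le]
        simp only [hg]
        constructor <;> nlinarith
      have fb : ∀ i : ℤ, 0 ≤ i → 0 < f i ∧ f i ≤ 1 := by
        intro i hi
        refine ⟨by simp only [hf]; positivity, ?_⟩
        simp only [hf]
        rw [inv_zpow]; exact inv_le_one_of_one_le₀ (one_le_zpow₀ (by linarith) hi)
      have b1 : g i * f j ≤ |g i| := by
        have := fb j hj
        calc g i * f j ≤ |g i| * f j := mul_le_mul_of_nonneg_right (le_abs_self _) this.1.le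
          _ ≤ |g i| * 1 := mul_le_mul_of_nonneg_left this.2 (abs_nonneg _)
          _ = _ := mul_one _
      have b2 : -(f i * g j) ≤ |g j| := by
        have := fb i (by omega)
        calc -(f i * g j) = f i * (- g j) := by ring
          _ ≤ f i * |g j| := mul_le_mul_of_nonneg_left (neg_le_abs _) this.1.le
          _ ≤ 1 * |g j| := mul_le_mul_of_nonneg_right this.2 (abs_nonneg _)
          _ = _ := one_mul _
      have b3 := gb i (by omega)
      have b4 := gb j hj
      have b5 : p ^ j ≤ p ^ i := zpow_le_zpow_right₀ hp.le hij.le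
      have b6 := mul_le_mul_of_nonneg_left b5 (add_pos hα hβ).le
      rw [hK]
      linarith)
  rw [div_mul_eq_mul_div, le_div_iff₀ hDpos]
  rw [mul_comm (p + p⁻¹)]
  exact this

/-- Glue a half path with the reversal of another half path. -/
def glue {m : ℕ} (s1 s2 : Fin m → Bool) : Fin (2 * m) → Bool := fun j =>
  if h : (j : ℕ) < m then s1 ⟨j, h⟩ else !(s2 ⟨2 * m - 1 - j, by omega⟩)

lemma hgt_glue_left {m : ℕ} (c : ℤ) (s1 s2 : Fin m → Bool) (t : ℕ) (ht : t ≤ m) :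
    hgt c (glue s1 s2) t = hgt c s1 t := by
  induction t with
  | zero => simp [hgt_zero]
  | succ t ih =>
    rw [hgt_succ _ _ t (by omega), hgt_succ _ _ t (by omega), ih (by omega)]
    have : t < m := by omega
    simp [glue, this]

lemma hgt_glue_right {m : ℕ} (c : ℤ) (s1 s2 : Fin m → Bool) (he : hgt c s1 m = hgt c s2 m)
    (u : ℕ) (hu : u ≤ m) : hgt c (glue s1 s2) (m + u) = hgt c s2 (m - u) := by
  induction u with
  | zero => simpa [hgt_glue_left] using he
  | succ u ih =>
    rw [← add_assoc, hgt_succ _ _ (m + u) (by omega), ih (by omega)]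
    have e : m - u = (m - (u + 1)) + 1 := by omega
    rw [e, hgt_succ _ _ (m - (u + 1)) (by omega)]
    have h1 : ¬ (m + u < m) := by omega
    have h2 : 2 * m - 1 - (m + u) = m - (u + 1) := by omega
    simp only [glue, h1, dif_neg, not_false_iff, eps_not, h2]
    ring

lemma glue_inj {m : ℕ} {s1 s2 r1 r2 : Fin m → Bool} (h : glue s1 s2 = glue r1 r2) :
    s1 = r1 ∧ s2 = r2 := by
  constructor
  · funext j
    have := congrFun h ⟨j, by omega⟩
    simpa [glue] using this
  · funext j
    have := congrFun h ⟨2 * m - 1 - j, by omega⟩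
    have h1 : ¬ (2 * m - 1 - (j : ℕ) < m) := by omega
    have h2 : 2 * m - 1 - (2 * m - 1 - (j : ℕ)) = j := by omega
    simpa [glue, h1, h2] using this

lemma visits_glue {m : ℕ} (c : ℤ) (s1 s2 : Fin m → Bool) (he : hgt c s1 m = hgt c s2 m) :
    visits c s1 + visits c s2 ≤ visits c (glue s1 s2) + 1 := by
  simp only [visits, Finset.card_filter]
  have h2 : ∑ i ∈ range (m + 1), (if hgt c s2 i = 0 then 1 else 0)
      = ∑ i ∈ range (m + 1), (if hgt c (glue s1 s2) (m + i) = 0 then 1 else 0) := by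
    rw [← Finset.sum_range_reflect]
    apply Finset.sum_congr rfl
    intro i hi
    rw [Finset.mem_range] at hi
    rw [hgt_glue_right c s1 s2 he i (by omega)]
    have : m + 1 - 1 - i = m - i := by omega
    rw [this]
  have h1 : ∑ i ∈ range (m + 1), (if hgt c s1 i = 0 then 1 else 0)
      = ∑ i ∈ range (m + 1), (if hgt c (glue s1 s2) i = 0 then 1 else 0) := by
    apply Finset.sum_congr rfl
    intro i hi
    rw [Finset.mem_range] at hi
    rw [hgt_glue_left c s1 s2 i (by omega)]
  rw [h1, h2, show 2 * m + 1 = m + (m + 1) by ring, Finset.sum_range_add _ m (m + 1),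
    Finset.sum_range_succ]
  have : (if hgt c (glue s1 s2) m = 0 then 1 else 0) ≤ 1 := by split_ifs <;> norm_num
  omega

/-- Weight of a full polygon. -/
noncomputable def Pw (n : ℕ) (a y : ℝ) (X : Fin (n + 1) × (Fin n → Bool) × (Fin n → Bool)) : ℝ :=
  a ^ visits ((X.1 : ℕ) : ℤ) X.2.2 * y ^ hgt ((X.1 : ℕ) : ℤ) X.2.1 (n / 2)

lemma Pw_nonneg {n : ℕ} {a y : ℝ} (ha : 0 ≤ a) (hy : 0 ≤ y) (X) : 0 ≤ Pw n a y X :=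
  mul_nonneg (pow_nonneg ha _) (zpow_nonneg hy _)

/-- The set of polygons. -/
noncomputable def Pset (n : ℕ) : Finset (Fin (n + 1) × (Fin n → Bool) × (Fin n → Bool)) :=
  Finset.univ.filter (fun p => IsStaircase ((p.1 : ℕ) : ℤ) p.2.1 p.2.2)

lemma PS_eq (n : ℕ) (a y : ℝ) : PS n a y = ∑ X ∈ Pset n, Pw n a y X := rfl

/-- Data matched when gluing. -/
def keyOf {m : ℕ} (X : Fin (m + 1) × (Fin m → Bool) × (Fin m → Bool)) : Fin (m + 1) × ℤ × ℤ :=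
  (X.1, hgt ((X.1 : ℕ) : ℤ) X.2.1 m, hgt ((X.1 : ℕ) : ℤ) X.2.2 m)

/-- Glue two half polygons. -/
def glueP {m : ℕ} (Z : (Fin (m + 1) × (Fin m → Bool) × (Fin m → Bool)) ×
    (Fin (m + 1) × (Fin m → Bool) × (Fin m → Bool))) :
    Fin (2 * m + 1) × (Fin (2 * m) → Bool) × (Fin (2 * m) → Bool) :=
  (⟨Z.1.1, by omega⟩, glue Z.1.2.1 Z.2.2.1, glue Z.1.2.2 Z.2.2.2)

lemma glue_staircase {m : ℕ} (c : ℤ) (p1 m1 p2 m2 : Fin m → Bool)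
    (h1 : IsHalf c p1 m1) (h2 : IsHalf c p2 m2)
    (hp : hgt c p1 m = hgt c p2 m) (hm : hgt c m1 m = hgt c m2 m) :
    IsStaircase c (glue p1 p2) (glue m1 m2) := by
  obtain ⟨a1, b1, t1, ht1, d1⟩ := h1
  obtain ⟨a2, b2, -⟩ := h2
  have split : ∀ i ≤ 2 * m, (i ≤ m) ∨ ∃ u ≤ m, i = m + u := by
    intro i hi
    by_cases h : i ≤ m
    · exact Or.inl h
    · exact Or.inr ⟨i - m, by omega, by omega⟩
  have hlow : InUHP c (glue m1 m2) := by
    intro i hi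
    rcases split i hi with h | ⟨u, hu, rfl⟩
    · rw [hgt_glue_left _ _ _ _ h]; exact b1 i h
    · rw [hgt_glue_right _ _ _ hm _ hu]; exact b2 _ (by omega)
  have hend : hgt c (glue p1 p2) (2 * m) = hgt c (glue m1 m2) (2 * m) := by
    have h1 := hgt_glue_right _ _ _ hp m le_rfl
    have h2 := hgt_glue_right _ _ _ hm m le_rfl
    simp only [← two_mul, Nat.sub_self, hgt_zero] at h1 h2
    rw [h1, h2]
  have hst : ∀ i, 0 < i → i < 2 * m → hgt c (glue m1 m2) i < hgt c (glue p1 p2) i := by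
    intro i hi hi'
    rcases split i hi'.le with h | ⟨u, hu, rfl⟩
    · rw [hgt_glue_left _ _ _ _ h, hgt_glue_left _ _ _ _ h]; exact a1 i hi h
    · rw [hgt_glue_right _ _ _ hm _ hu, hgt_glue_right _ _ _ hp _ hu]
      exact a2 _ (by omega) (by omega)
  refine ⟨hend, hst, ?_, hlow, t1, by omega, Or.inr ?_⟩
  · intro i hi
    have h0 := hlow i hi
    rcases Nat.eq_zero_or_pos i with rfl | hpos
    · rw [hgt_zero] at *; exact h0
    · rcases hi.eq_or_lt with rfl | hlt
      · rw [hend]; exact h0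
      · have := hst i hpos hlt; omega
  · rw [hgt_glue_left _ _ _ _ ht1]; exact d1

lemma glue_bound (m : ℕ) (a p : ℝ) (ha : 1 ≤ a) (hp : 0 < p) :
    (Rh m a p) ^ 2 ≤ ((m + 1) * ((2 * m + 1) * (2 * m + 1))) * (a * PS (2 * m) a (p ^ 2)) := by
  set K : Finset (Fin (m + 1) × ℤ × ℤ) :=
    Finset.univ ×ˢ (Finset.Icc 0 (2 * m : ℤ) ×ˢ Finset.Icc 0 (2 * m : ℤ)) with hK
  have hmaps : ∀ X ∈ Hset m, keyOf X ∈ K := by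
    intro X hX
    simp only [Hset, Finset.mem_filter, Finset.mem_univ, true_and] at hX
    obtain ⟨h1, h2, -⟩ := hX
    have hc := X.1.2
    have e1 := (hgt_diff_le ((X.1 : ℕ) : ℤ) X.2.1 m le_rfl).1
    have e2 := (hgt_diff_le ((X.1 : ℕ) : ℤ) X.2.2 m le_rfl).1
    have e3 := h2 m le_rfl
    have e4 : 0 ≤ hgt ((X.1 : ℕ) : ℤ) X.2.1 m := by
      rcases Nat.eq_zero_or_pos m with h | hpos
      · subst h; rw [hgt_zero]; omega
      · have := h1 m hpos le_rfl; omega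
    simp only [hK, keyOf, Finset.mem_product, Finset.mem_univ, Finset.mem_Icc, true_and]
    omega
  have hKcard : (K.card : ℝ) = (m + 1) * ((2 * m + 1) * (2 * m + 1)) := by
    simp only [hK, Finset.card_product, Finset.card_univ, Fintype.card_fin, Int.card_Icc]
    have : (2 * (m : ℤ) + 1 - 0).toNat = 2 * m + 1 := by omega
    rw [this]
    push_cast
    ring
  have e1 : Rh m a p = ∑ k ∈ K, ∑ X ∈ (Hset m).filter (fun X => keyOf X = k), Hw m a p X := by
    rw [Rh, Finset.sum_fiberwise_of_maps_to hmaps]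
  have e2 := sq_sum_le_card_mul_sum_sq (s := K)
    (f := fun k => ∑ X ∈ (Hset m).filter (fun X => keyOf X = k), Hw m a p X)
  rw [← e1, hKcard] at e2
  refine e2.trans ?_
  apply mul_le_mul_of_nonneg_left _ (by positivity)
  set Pairs := (Hset m ×ˢ Hset m).filter (fun Z => keyOf Z.1 = keyOf Z.2) with hPairs
  have e3 : ∑ k ∈ K, (∑ X ∈ (Hset m).filter (fun X => keyOf X = k), Hw m a p X) ^ 2
      = ∑ Z ∈ Pairs, Hw m a p Z.1 * Hw m a p Z.2 := by
    rw [← Finset.sum_fiberwise_of_maps_to (s := Pairs) (t := K) (g := fun Z => keyOf Z.1)]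
    · apply Finset.sum_congr rfl
      intro k _
      rw [sq, Finset.sum_mul_sum, ← Finset.sum_product']
      apply Finset.sum_congr _ (fun _ _ => rfl)
      ext Z
      simp only [hPairs, Finset.mem_product, Finset.mem_filter]
      constructor
      · rintro ⟨⟨h1, h2⟩, h3, h4⟩
        exact ⟨⟨⟨h1, h3⟩, h2.trans h4.symm⟩, h2⟩
      · rintro ⟨⟨⟨h1, h3⟩, h2⟩, h4⟩
        exact ⟨⟨h1, h4⟩, h3, h2.symm.trans h4⟩
    · intro Z hZ
      simp only [hPairs, Finset.mem_product, Finset.mem_filter] at hZ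
      exact hmaps _ hZ.1.1
  rw [e3, PS_eq, Finset.mul_sum]
  refine sum_le_of_inj _ _ _ _ glueP ?_ ?_ ?_ ?_
  · rintro ⟨⟨c1, p1, m1⟩, ⟨c2, p2, m2⟩⟩ hZ
    simp only [hPairs, Finset.mem_product, Finset.mem_filter, Hset, Finset.mem_univ, true_and,
      keyOf, Prod.mk.injEq] at hZ
    obtain ⟨⟨h1, h2⟩, rfl, hp, hm⟩ := hZ
    simp only [Pset, Finset.mem_filter, Finset.mem_univ, true_and, glueP]
    exact glue_staircase _ _ _ _ _ h1 h2 hp hm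
  · rintro ⟨⟨c1, p1, m1⟩, ⟨c2, p2, m2⟩⟩ hZ ⟨⟨c1', p1', m1'⟩, ⟨c2', p2', m2'⟩⟩ hZ' h
    simp only [hPairs, Finset.coe_filter, Set.mem_ofPred_eq, Finset.mem_product, keyOf,
      Prod.mk.injEq] at hZ hZ'
    simp only [glueP, Prod.mk.injEq, Fin.mk.injEq] at h
    obtain ⟨h1, h2, h3⟩ := h
    obtain ⟨rfl, rfl⟩ := glue_inj h2
    obtain ⟨rfl, rfl⟩ := glue_inj h3
    have : c1 = c1' := Fin.ext h1
    have h5 := hZ.2.1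
    have h6 := hZ'.2.1
    subst this
    rw [← h5, ← h6]
  · rintro ⟨⟨c1, p1, m1⟩, ⟨c2, p2, m2⟩⟩ hZ
    simp only [hPairs, Finset.mem_product, Finset.mem_filter, keyOf, Prod.mk.injEq] at hZ
    obtain ⟨-, rfl, hpp, hmm⟩ := hZ
    simp only [Hw, Pw, glueP]
    have hh : 2 * m / 2 = m := by omega
    rw [hh, hgt_glue_left _ _ _ _ le_rfl, ← hpp]
    have hv := visits_glue _ _ _ hmm
    have e : (p ^ 2) ^ (hgt ((c1 : ℕ) : ℤ) p1 m)
        = p ^ (hgt ((c1 : ℕ) : ℤ) p1 m) * p ^ (hgt ((c1 : ℕ) : ℤ) p1 m) := by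
      rw [← mul_zpow, sq]
    rw [e]
    have h1 := pow_le_pow_right₀ ha hv
    rw [pow_add, pow_succ] at h1
    have h2 : 0 ≤ p ^ (hgt ((c1 : ℕ) : ℤ) p1 m) * p ^ (hgt ((c1 : ℕ) : ℤ) p1 m) := by positivity
    have h3 := mul_le_mul_of_nonneg_right h1 h2
    refine le_trans (le_of_eq ?_) (h3.trans (le_of_eq ?_)) <;> ring
  · intro X _
    exact mul_nonneg (by linarith) (Pw_nonneg (by linarith) (by positivity) _)

/-- Extension of the upper path by one step. -/
def extP {n : ℕ} (s : Fin (n + 1) → Bool) : Fin (n + 2) → Bool := fun j =>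
  if h : (j : ℕ) < n then s ⟨j, by omega⟩ else decide ((j : ℕ) = n)

/-- Extension of the lower path by one step. -/
def extM {n : ℕ} (s : Fin (n + 1) → Bool) : Fin (n + 2) → Bool := fun j =>
  if h : (j : ℕ) < n + 1 then s ⟨j, h⟩ else true

lemma hgt_extP {n : ℕ} (c : ℤ) (s : Fin (n + 1) → Bool) (t : ℕ) (ht : t ≤ n) :
    hgt c (extP s) t = hgt c s t := by
  induction t with
  | zero => simp [hgt_zero]
  | succ t ih =>
    rw [hgt_succ _ _ t (by omega), hgt_succ _ _ t (by omega), ih (by omega)]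
    have : t < n := by omega
    simp [extP, this]

lemma hgt_extP1 {n : ℕ} (c : ℤ) (s : Fin (n + 1) → Bool) :
    hgt c (extP s) (n + 1) = hgt c s n + 1 := by
  rw [hgt_succ _ _ n (by omega), hgt_extP _ _ _ le_rfl]
  simp [extP, eps]

lemma hgt_extP2 {n : ℕ} (c : ℤ) (s : Fin (n + 1) → Bool) :
    hgt c (extP s) (n + 2) = hgt c s n := by
  rw [hgt_succ _ _ (n + 1) (by omega), hgt_extP1]
  simp [extP, eps]

lemma hgt_extM {n : ℕ} (c : ℤ) (s : Fin (n + 1) → Bool) (t : ℕ) (ht : t ≤ n + 1) :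
    hgt c (extM s) t = hgt c s t := by
  induction t with
  | zero => simp [hgt_zero]
  | succ t ih =>
    rw [hgt_succ _ _ t (by omega), hgt_succ _ _ t (by omega), ih (by omega)]
    have : t < n + 1 := by omega
    simp [extM, this]

lemma hgt_extM1 {n : ℕ} (c : ℤ) (s : Fin (n + 1) → Bool) :
    hgt c (extM s) (n + 2) = hgt c s (n + 1) + 1 := by
  rw [hgt_succ _ _ (n + 1) (by omega), hgt_extM _ _ _ le_rfl]
  simp [extM, eps]

lemma stair_last {n : ℕ} (hn : 0 < n) (c : ℤ) (sp sm : Fin (n + 1) → Bool)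
    (h : IsStaircase c sp sm) : sp ⟨n, by omega⟩ = false ∧ hgt c sm (n + 1) = hgt c sp n - 1 := by
  obtain ⟨h1, h2, -⟩ := h
  have h3 := h2 n hn (by omega)
  have e1 := hgt_succ c sp n (by omega)
  have e2 := hgt_succ c sm n (by omega)
  have : sp ⟨n, by omega⟩ = false := by
    by_contra hcon
    rw [Bool.not_eq_false] at hcon
    rw [hcon, eps_true] at e1
    have := eps_le (sm ⟨n, by omega⟩)
    omega
  refine ⟨this, ?_⟩
  rw [this, eps_false] at e1
  omega

lemma PS_odd (n : ℕ) (hn : 0 < n) (hpar : (n + 2) / 2 = (n + 1) / 2) (a y : ℝ) (ha : 0 < a)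
    (hy : 0 < y) : PS (n + 1) a y ≤ PS (n + 2) a y := by
  rw [PS_eq, PS_eq]
  refine sum_le_of_inj _ _ _ _
    (fun X => (⟨X.1, by omega⟩, extP X.2.1, extM X.2.2)) ?_ ?_ ?_ ?_
  · rintro ⟨c, sp, sm⟩ hX
    simp only [Pset, Finset.mem_filter, Finset.mem_univ, true_and] at hX ⊢
    have hl := (stair_last hn _ _ _ hX).2
    obtain ⟨h1, h2, h3, h4, h5⟩ := hX
    refine ⟨?_, ?_, ?_, ?_, ?_⟩
    · rw [hgt_extP2, hgt_extM1, hl]; ring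
    · intro i hi hi'
      rcases (show i ≤ n + 1 by omega).eq_or_lt with rfl | hlt
      · rw [hgt_extP1, hgt_extM _ _ _ le_rfl, hl]; omega
      · rw [hgt_extP _ _ _ (by omega), hgt_extM _ _ _ (by omega)]
        exact h2 i hi hlt
    · intro i hi
      have := h3 n (by omega)
      rcases hi.eq_or_lt with rfl | hlt
      · rw [hgt_extP2]; exact this
      · rcases (show i ≤ n + 1 by omega).eq_or_lt with rfl | hlt
        · rw [hgt_extP1]; omega
        · rw [hgt_extP _ _ _ (by omega)]
          exact h3 i (by omega)
    · intro i hi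
      rcases hi.eq_or_lt with rfl | hlt
      · rw [hgt_extM1]; have := h4 (n + 1) le_rfl; omega
      · rw [hgt_extM _ _ _ (by omega)]
        exact h4 i (by omega)
    · obtain ⟨i, hi, hor⟩ := h5
      refine ⟨i, by omega, ?_⟩
      rw [hgt_extM _ _ _ hi]
      rcases hor with h | h
      · rcases hi.eq_or_lt with rfl | hlt
        · right; rw [← h1]; exact h
        · left; rw [hgt_extP _ _ _ (by omega)]; exact h
      · right; exact h
  · rintro ⟨c, sp, sm⟩ hX ⟨c', sp', sm'⟩ hX' h
    rw [Finset.mem_coe] at hX hX'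
    simp only [Pset, Finset.mem_filter, Finset.mem_univ, true_and] at hX hX'
    have hl := (stair_last hn _ _ _ hX).1
    have hl' := (stair_last hn _ _ _ hX').1
    simp only [Prod.mk.injEq, Fin.mk.injEq] at h
    obtain ⟨h1, h2, h3⟩ := h
    have h1' : c = c' := Fin.ext h1
    have h2' : sp = sp' := by
      funext j
      by_cases hj : (j : ℕ) < n
      · have := congrFun h2 ⟨j, by omega⟩
        simpa [extP, hj] using this
      · have : j = ⟨n, by omega⟩ := Fin.ext (by simp; omega)
        rw [this, hl, hl']
    have h3' : sm = sm' := by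
      funext j
      have := congrFun h3 ⟨j, by omega⟩
      have hj : (j : ℕ) < n + 1 := j.2
      simpa only [extM, hj, dif_pos] using this
    rw [h1', h2', h3']
  · rintro ⟨c, sp, sm⟩ hX
    simp only [Pset, Finset.mem_filter, Finset.mem_univ, true_and] at hX
    simp only [Pw]
    rw [hpar, hgt_extP _ _ _ (by omega)]
    have : visits ((c : ℕ) : ℤ) (extM sm) = visits ((c : ℕ) : ℤ) sm := by
      simp only [visits, Finset.card_filter]
      rw [Finset.sum_range_succ _ (n + 2), hgt_extM1]
      have := hX.2.2.2.1 (n + 1) le_rfl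
      rw [if_neg (by omega), add_zero]
      apply Finset.sum_congr rfl
      intro i hi
      rw [Finset.mem_range] at hi
      rw [hgt_extM _ _ _ (by omega)]
    rw [this]
  · intro X _
    exact Pw_nonneg ha.le hy.le _

lemma InUHP_cons {n : ℕ} (c : ℤ) (b : Bool) (s : Fin n → Bool) :
    InUHP c (Fin.cons b s : Fin (n + 1) → Bool) ↔ 0 ≤ c ∧ InUHP (c + eps b) s := by
  constructor
  · intro h
    refine ⟨by simpa [hgt_zero] using h 0 (by omega), ?_⟩
    intro i hi
    have := h (i + 1) (by omega)
    rwa [hgt_cons] at this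
  · rintro ⟨h0, h⟩ i hi
    cases i with
    | zero => rwa [hgt_zero]
    | succ i => rw [hgt_cons]; exact h i (by omega)

/-- touching the axis -/
def Touch {n : ℕ} (c : ℤ) (s : Fin n → Bool) : Prop := ∃ t ≤ n, hgt c s t = 0

lemma Touch_cons {n : ℕ} (c : ℤ) (b : Bool) (s : Fin n → Bool) :
    Touch c (Fin.cons b s : Fin (n + 1) → Bool) ↔ c = 0 ∨ Touch (c + eps b) s := by
  constructor
  · rintro ⟨t, ht, h⟩
    cases t with
    | zero => left; rwa [hgt_zero] at h
    | succ t => right; exact ⟨t, by omega, by rwa [hgt_cons] at h⟩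
  · rintro (h | ⟨t, ht, h⟩)
    · exact ⟨0, by omega, by rwa [hgt_zero]⟩
    · exact ⟨t + 1, by omega, by rwa [hgt_cons]⟩

/-- half-line path sum -/
noncomputable def Gs (a q : ℝ) (k : ℕ) (c : ℤ) : ℝ :=
  ∑ s : Fin k → Bool, if InUHP c s then a ^ visits c s * q ^ hgt c s k else 0

/-- touching half-line path sum -/
noncomputable def Hs (a q : ℝ) (k : ℕ) (c : ℤ) : ℝ :=
  ∑ s : Fin k → Bool, if InUHP c s ∧ Touch c s then a ^ visits c s * q ^ hgt c s k else 0

lemma Gs_succ (a q : ℝ) (k : ℕ) (c : ℤ) (hc : 0 ≤ c) :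
    Gs a q (k + 1) c = (if c = 0 then a else 1) * (Gs a q k (c + 1) + Gs a q k (c - 1)) := by
  unfold Gs
  rw [sum_cons]
  simp only [InUHP_cons, visits_cons, hgt_cons, eps_true, eps_false, hc, true_and]
  rw [← sub_eq_add_neg, mul_add, Finset.mul_sum, Finset.mul_sum]
  congr 1 <;>
  · apply Finset.sum_congr rfl
    intro s _
    split_ifs <;> simp [pow_succ] <;> ring

lemma Gs_neg (a q : ℝ) (k : ℕ) (c : ℤ) (hc : c < 0) : Gs a q k c = 0 := by
  unfold Gs
  apply Finset.sum_eq_zero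
  intro s _
  rw [if_neg]
  intro h
  have := h 0 (by omega)
  rw [hgt_zero] at this
  omega

lemma Hs_succ (a q : ℝ) (k : ℕ) (c : ℤ) (hc : 0 < c) :
    Hs a q (k + 1) c = Hs a q k (c + 1) + Hs a q k (c - 1) := by
  unfold Hs
  rw [sum_cons]
  simp only [InUHP_cons, Touch_cons, visits_cons, hgt_cons, eps_true, eps_false, hc.le, true_and,
    hc.ne', false_or, if_false, add_zero]
  rw [← sub_eq_add_neg]

lemma Hs_le_Gs (a q : ℝ) (ha : 0 ≤ a) (hq : 0 ≤ q) (k : ℕ) (c : ℤ) : Hs a q k c ≤ Gs a q k c := by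
  unfold Hs Gs
  apply Finset.sum_le_sum
  intro s _
  have : 0 ≤ a ^ visits c s * q ^ hgt c s k := mul_nonneg (pow_nonneg ha _) (zpow_nonneg hq _)
  by_cases h1 : InUHP c s <;> by_cases h2 : Touch c s <;> simp [h1, h2, this]

lemma visits_zero_le (c : ℤ) (s : Fin 0 → Bool) : visits c s = if c = 0 then 1 else 0 := by
  simp only [visits, Finset.card_filter]
  rw [zero_add, Finset.sum_range_one, hgt_zero]

lemma Gs_bound (q : ℝ) (hq : 1 ≤ q) (k : ℕ) : ∀ c : ℤ, 0 ≤ c →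
    Gs (q ^ 2 + 1) q k c ≤ (q ^ 2 + 1) * (q + q⁻¹) ^ k * (q ^ c + k * q ^ 2 * (q⁻¹) ^ c) := by
  have hq0 : 0 < q := by linarith
  induction k with
  | zero =>
    intro c hc
    have hqc : 0 < q ^ c := by positivity
    have : Gs (q ^ 2 + 1) q 0 c ≤ (q ^ 2 + 1) * q ^ c := by
      unfold Gs
      rw [Fintype.sum_unique]
      rw [visits_zero_le, hgt_zero]
      have : 0 < (q ^ 2) * q ^ c := by positivity
      split_ifs <;> first | positivity | (simp; try nlinarith)
    simpa using this
  | succ k ih =>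
    intro c hc
    rw [Gs_succ _ _ _ _ hc]
    have h1 := ih (c + 1) (by omega)
    have z1 := zpow_eig q hq0.ne' c
    have z2 := zpow_eig q⁻¹ (by positivity) c
    rw [inv_inv] at z2
    have hl : 0 < (q ^ 2 + 1) * (q + q⁻¹) ^ k := by positivity
    rcases hc.eq_or_lt with h0 | hpos
    · subst h0
      rw [if_pos rfl, Gs_neg _ _ _ (0 - 1) (by norm_num), add_zero]
      simp only [zero_add, zpow_one, zpow_zero, mul_one] at *
      have e : (q ^ 2 + 1) * ((q ^ 2 + 1) * (q + q⁻¹) ^ k * (q + k * q ^ 2 * q⁻¹))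
          = (q ^ 2 + 1) * (q + q⁻¹) ^ (k + 1) * ((k + 1) * q ^ 2) := by
        rw [pow_succ (q + q⁻¹) k]; generalize (q + q⁻¹) ^ k = L; field_simp; ring
      calc _ ≤ (q ^ 2 + 1) * ((q ^ 2 + 1) * (q + q⁻¹) ^ k * (q + k * q ^ 2 * q⁻¹)) :=
            mul_le_mul_of_nonneg_left h1 (by positivity)
        _ = _ := e
        _ ≤ _ := by
          apply mul_le_mul_of_nonneg_left _ (by positivity)
          push_cast; linarith
    · rw [if_neg hpos.ne', one_mul]
      have h2 := ih (c - 1) (by omega)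
      have h3 : 0 < (q ^ 2 + 1) * (q + q⁻¹) ^ (k + 1) * (q ^ 2 * (q⁻¹) ^ c) := by positivity
      calc _ ≤ _ := add_le_add h1 h2
        _ = (q ^ 2 + 1) * (q + q⁻¹) ^ (k + 1) * (q ^ c + k * q ^ 2 * (q⁻¹) ^ c) := by
          rw [pow_succ]
          linear_combination ((q ^ 2 + 1) * (q + q⁻¹) ^ k) * z1
            + ((q ^ 2 + 1) * (q + q⁻¹) ^ k * k * q ^ 2) * z2
        _ ≤ _ := by push_cast; nlinarith

lemma Hs_bound (q : ℝ) (hq : 1 ≤ q) (k : ℕ) : ∀ c : ℤ, 0 ≤ c →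
    Hs (q ^ 2 + 1) q k c ≤ (q ^ 2 + 1) * q ^ 2 * (q + q⁻¹) ^ k * (k + 1) * (q⁻¹) ^ c := by
  have hq0 : 0 < q := by linarith
  have hz : ∀ k, Hs (q ^ 2 + 1) q k 0
      ≤ (q ^ 2 + 1) * q ^ 2 * (q + q⁻¹) ^ k * (k + 1) * (q⁻¹) ^ (0 : ℤ) := by
    intro k
    have h1 := Hs_le_Gs (q ^ 2 + 1) q (by positivity) hq0.le k 0
    have h2 := Gs_bound q hq k 0 le_rfl
    refine h1.trans (h2.trans ?_)
    have h3 : 0 < (q ^ 2 + 1) * (q + q⁻¹) ^ k := by positivity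
    have h4 : 1 ≤ q ^ 2 := by nlinarith
    simp only [zpow_zero, mul_one]
    nlinarith
  induction k with
  | zero =>
    intro c hc
    rcases hc.eq_or_lt with h0 | hpos
    · subst h0; exact hz 0
    · have : Hs (q ^ 2 + 1) q 0 c = 0 := by
        unfold Hs
        apply Finset.sum_eq_zero
        intro s _
        rw [if_neg]
        rintro ⟨-, t, ht, h⟩
        have : t = 0 := by omega
        subst this
        rw [hgt_zero] at h
        omega
      rw [this]; positivity
  | succ k ih =>
    intro c hc
    rcases hc.eq_or_lt with h0 | hpos
    · subst h0; exact hz _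
    · rw [Hs_succ _ _ _ _ hpos]
      have z2 := zpow_eig q⁻¹ (by positivity) c
      rw [inv_inv] at z2
      have h3 : 0 < (q ^ 2 + 1) * q ^ 2 * (q + q⁻¹) ^ (k + 1) * (q⁻¹) ^ c := by positivity
      calc _ ≤ _ := add_le_add (ih (c + 1) (by omega)) (ih (c - 1) (by omega))
        _ = (q ^ 2 + 1) * q ^ 2 * (q + q⁻¹) ^ (k + 1) * (k + 1) * (q⁻¹) ^ c := by
          rw [pow_succ]
          linear_combination ((q ^ 2 + 1) * q ^ 2 * (q + q⁻¹) ^ k * (k + 1)) * z2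
        _ ≤ _ := by push_cast; nlinarith

lemma upper_sum (p : ℝ) (hp : 0 < p) (n : ℕ) : ∀ (m : ℕ) (c : ℤ), m ≤ n →
    ∑ s : Fin n → Bool, p ^ (2 * hgt c s m - c - hgt c s n) = (p + p⁻¹) ^ n := by
  induction n with
  | zero =>
    intro m c hm
    have : m = 0 := by omega
    subst this
    simp [hgt_zero, two_mul]
  | succ n ih =>
    intro m c hm
    rw [sum_cons]
    cases m with
    | zero =>
      simp only [hgt_zero, hgt_cons, eps_true, eps_false]
      have h1 := ih 0 (c + 1) (by omega)
      have h2 := ih 0 (c + -1) (by omega)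
      simp only [hgt_zero] at h1 h2
      have e1 : ∀ s : Fin n → Bool, p ^ (2 * c - c - hgt (c + 1) s n)
          = p ^ (2 * (c + 1) - (c + 1) - hgt (c + 1) s n) * p⁻¹ := by
        intro s
        rw [← zpow_neg_one p, ← zpow_add₀ hp.ne']; congr 1; ring
      have e2 : ∀ s : Fin n → Bool, p ^ (2 * c - c - hgt (c + -1) s n)
          = p ^ (2 * (c + -1) - (c + -1) - hgt (c + -1) s n) * p := by
        intro s
        rw [← zpow_add_one₀ hp.ne']; congr 1; ring
      simp only [e1, e2]
      rw [← Finset.sum_mul, ← Finset.sum_mul, h1, h2]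
      ring
    | succ m =>
      simp only [hgt_cons, eps_true, eps_false]
      have h1 := ih m (c + 1) (by omega)
      have h2 := ih m (c + -1) (by omega)
      have e1 : ∀ s : Fin n → Bool, p ^ (2 * hgt (c + 1) s m - c - hgt (c + 1) s n)
          = p ^ (2 * hgt (c + 1) s m - (c + 1) - hgt (c + 1) s n) * p := by
        intro s
        rw [← zpow_add_one₀ hp.ne']; congr 1; ring
      have e2 : ∀ s : Fin n → Bool, p ^ (2 * hgt (c + -1) s m - c - hgt (c + -1) s n)
          = p ^ (2 * hgt (c + -1) s m - (c + -1) - hgt (c + -1) s n) * p⁻¹ := by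
        intro s
        rw [← zpow_neg_one p, ← zpow_add₀ hp.ne']; congr 1; ring
      simp only [e1, e2]
      rw [← Finset.sum_mul, ← Finset.sum_mul, h1, h2]
      ring

lemma stair_touch {n : ℕ} (c : ℤ) (sp sm : Fin n → Bool) (h : IsStaircase c sp sm) :
    Touch c sm := by
  obtain ⟨h1, h2, h3, h4, i, hi, hor⟩ := h
  rcases hor with h | h
  · rcases hi.eq_or_lt with rfl | hlt
    · exact ⟨i, le_rfl, by rw [← h1]; exact h⟩
    · rcases Nat.eq_zero_or_pos i with rfl | hpos
      · exact ⟨0, by omega, by rw [hgt_zero] at *; exact h⟩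
      · have := h2 i hpos hlt
        have := h4 i hi
        omega
  · exact ⟨i, hi, h⟩

lemma PS_upper (n : ℕ) (a y p q : ℝ) (ha : 0 < a) (hy : 0 < y) (hp : 1 ≤ p) (hpq : p ≤ q)
    (hyp : y ≤ p ^ 2) (haq : a ≤ q ^ 2 + 1) :
    PS n a y ≤ ((q ^ 2 + 1) * q ^ 2) * (n + 1) ^ 2 * ((p + p⁻¹) * (q + q⁻¹)) ^ n := by
  have hp0 : 0 < p := by linarith
  have hq0 : 0 < q := by linarith
  set A : Fin (n + 1) → (Fin n → Bool) → ℝ := fun c s =>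
    q ^ ((c : ℕ) : ℤ) * (if InUHP ((c : ℕ) : ℤ) s ∧ Touch ((c : ℕ) : ℤ) s then
      (q ^ 2 + 1) ^ visits ((c : ℕ) : ℤ) s * q ^ hgt ((c : ℕ) : ℤ) s n else 0) with hA
  set B : Fin (n + 1) → (Fin n → Bool) → ℝ := fun c s =>
    p ^ (2 * hgt ((c : ℕ) : ℤ) s (n / 2) - ((c : ℕ) : ℤ) - hgt ((c : ℕ) : ℤ) s n) with hB
  have hA0 : ∀ c s, 0 ≤ A c s := by
    intro c s
    simp only [hA]
    apply mul_nonneg (by positivity)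
    split_ifs
    · positivity
    · exact le_rfl
  have hB0 : ∀ c s, 0 ≤ B c s := by
    intro c s; simp only [hB]; positivity
  have s1 : PS n a y ≤ ∑ X ∈ Pset n, B X.1 X.2.1 * A X.1 X.2.2 := by
    rw [PS_eq]
    apply Finset.sum_le_sum
    rintro ⟨c, sp, sm⟩ hX
    simp only [Pset, Finset.mem_filter, Finset.mem_univ, true_and] at hX
    have ht := stair_touch _ _ _ hX
    obtain ⟨h1, h2, h3, h4, h5⟩ := hX
    simp only [Pw, hA, hB, h4, ht, and_self, if_true]
    have hh := h3 (n / 2) (by omega)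
    have hd := h4 n le_rfl
    set h := hgt ((c : ℕ) : ℤ) sp (n / 2)
    rw [h1]
    set d := hgt ((c : ℕ) : ℤ) sm n
    set v := visits ((c : ℕ) : ℤ) sm
    have b1 : y ^ h ≤ (p ^ 2) ^ h := zpow_le_zpow_left₀ hh hy.le hyp
    have b2 : (p ^ 2) ^ h = p ^ (2 * h - ((c : ℕ) : ℤ) - d) * p ^ (((c : ℕ) : ℤ) + d) := by
      rw [← zpow_natCast, ← zpow_mul, ← zpow_add₀ hp0.ne']; congr 1; push_cast; ring
    have b3 : p ^ (((c : ℕ) : ℤ) + d) ≤ q ^ (((c : ℕ) : ℤ) + d) :=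
      zpow_le_zpow_left₀ (by omega) hp0.le hpq
    have b4 : q ^ (((c : ℕ) : ℤ) + d) = q ^ ((c : ℕ) : ℤ) * q ^ d := zpow_add₀ hq0.ne' _ _
    have b5 : a ^ v ≤ (q ^ 2 + 1) ^ v := pow_le_pow_left₀ ha.le haq v
    calc a ^ v * y ^ h ≤ (q ^ 2 + 1) ^ v *
          (p ^ (2 * h - ((c : ℕ) : ℤ) - d) * q ^ (((c : ℕ) : ℤ) + d)) := by
          apply mul_le_mul b5 _ (by positivity) (by positivity)
          rw [b2] at b1
          exact b1.trans (mul_le_mul_of_nonneg_left b3 (by positivity))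
      _ = _ := by rw [b4]; ring
  have s2 : ∑ X ∈ Pset n, B X.1 X.2.1 * A X.1 X.2.2
      ≤ ∑ X : Fin (n + 1) × (Fin n → Bool) × (Fin n → Bool), B X.1 X.2.1 * A X.1 X.2.2 :=
    Finset.sum_le_sum_of_subset_of_nonneg (Finset.subset_univ _)
      (fun X _ _ => mul_nonneg (hB0 _ _) (hA0 _ _))
  refine s1.trans (s2.trans ?_)
  rw [Fintype.sum_prod_type]
  have s3 : ∀ c : Fin (n + 1), ∑ x : (Fin n → Bool) × (Fin n → Bool), B c x.1 * A c x.2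
      ≤ (p + p⁻¹) ^ n * ((q ^ 2 + 1) * q ^ 2 * (q + q⁻¹) ^ n * (n + 1)) := by
    intro c
    rw [Fintype.sum_prod_type]
    simp only
    rw [← Finset.sum_mul_sum]
    have u1 : ∑ s, B c s = (p + p⁻¹) ^ n := upper_sum p hp0 n (n / 2) _ (by omega)
    have u2 : ∑ s, A c s = q ^ ((c : ℕ) : ℤ) * Hs (q ^ 2 + 1) q n ((c : ℕ) : ℤ) := by
      simp only [hA, Hs, Finset.mul_sum]
    rw [u1, u2]
    apply mul_le_mul_of_nonneg_left _ (by positivity)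
    have u3 := mul_le_mul_of_nonneg_left (Hs_bound q (hp.trans hpq) n ((c : ℕ) : ℤ) (by omega))
      (show 0 ≤ q ^ ((c : ℕ) : ℤ) by positivity)
    refine u3.trans (le_of_eq ?_)
    have : q ^ ((c : ℕ) : ℤ) * (q⁻¹) ^ ((c : ℕ) : ℤ) = 1 := by
      rw [← mul_zpow, mul_inv_cancel₀ hq0.ne', one_zpow]
    linear_combination ((q ^ 2 + 1) * q ^ 2 * (q + q⁻¹) ^ n * (n + 1)) * this
  refine (Finset.sum_le_sum (fun c _ => s3 c)).trans (le_of_eq ?_)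
  rw [Finset.sum_const, Finset.card_univ, Fintype.card_fin, nsmul_eq_mul, mul_pow]
  push_cast
  ring

/-- single-path growth exponent -/
noncomputable def ell (Y : ℝ) : ℝ := Real.log (Real.sqrt Y + (Real.sqrt Y)⁻¹)

/-- the limiting free energy -/
noncomputable def Psi (a y : ℝ) : ℝ := (ell (max y 1) + ell (max (max y 1) (a - 1))) / 2

lemma ell_eq (Y : ℝ) (hY : 0 < Y) : ell Y = Real.log (Y + 1) - (1 / 2) * Real.log Y := by
  have h := Real.sqrt_pos.mpr hY
  have : Real.sqrt Y + (Real.sqrt Y)⁻¹ = (Y + 1) / Real.sqrt Y := by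
    field_simp
    rw [Real.sq_sqrt hY.le]
  rw [ell, this, Real.log_div (by positivity) h.ne', Real.log_sqrt hY.le]
  ring

lemma lam_mono (s t : ℝ) (hs : 1 ≤ s) (hst : s ≤ t) : s + s⁻¹ ≤ t + t⁻¹ := by
  have h0 : 0 < s := by linarith
  have h1 : 0 < t := by linarith
  have : t + t⁻¹ - (s + s⁻¹) = (t - s) * (s * t - 1) / (s * t) := by field_simp; ring
  have h2 : 0 ≤ (t - s) * (s * t - 1) / (s * t) := by
    apply div_nonneg _ (by positivity)
    apply mul_nonneg (by linarith)
    nlinarith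
  linarith

lemma ell_mono (s t : ℝ) (hs : 1 ≤ s) (hst : s ≤ t) : ell s ≤ ell t := by
  have h1 : 1 ≤ Real.sqrt s := by rw [Real.one_le_sqrt]; exact hs
  apply Real.log_le_log (by positivity)
  exact lam_mono _ _ h1 (Real.sqrt_le_sqrt hst)

lemma ell_exp (z : ℝ) : ell (Real.exp z) ≤ ell 1 + z ^ 2 / 8 := by
  have : Real.sqrt (Real.exp z) = Real.exp (z / 2) := by rw [Real.exp_half]
  have h1 : ell (Real.exp z) = Real.log (2 * Real.cosh (z / 2)) := by
    rw [ell, this, ← Real.exp_neg, Real.cosh_eq]; congr 1; ring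
  have h2 : ell 1 = Real.log 2 := by rw [ell]; norm_num
  rw [h1, h2, Real.log_mul (by norm_num) (Real.cosh_pos _).ne']
  have := Real.log_le_log (Real.cosh_pos _) (Real.cosh_le_exp_half_sq (z / 2))
  rw [Real.log_exp] at this
  nlinarith

lemma Psi_bounds (a z : ℝ) (hz : 0 ≤ z) :
    Psi a 1 ≤ Psi a (Real.exp z) ∧ Psi a (Real.exp z) ≤ Psi a 1 + z ^ 2 / 8 := by
  have he : 1 ≤ Real.exp z := Real.one_le_exp hz
  have h1 : max (Real.exp z) 1 = Real.exp z := max_eq_left he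
  have h0 := ell_exp z
  have hm := ell_mono 1 _ le_rfl he
  have k1 := ell_mono (max 1 (a - 1)) (max (Real.exp z) (a - 1)) (le_max_left _ _)
    (max_le_max_right _ he)
  have k2 : ell (max (Real.exp z) (a - 1)) ≤ ell (max 1 (a - 1)) + z ^ 2 / 8 := by
    rcases le_total (Real.exp z) (a - 1) with h | h
    · rw [max_eq_right h, max_eq_right (he.trans h)]
      nlinarith [sq_nonneg z]
    · rw [max_eq_left h]
      have := ell_mono 1 (max 1 (a - 1)) le_rfl (le_max_left _ _)
      linarith
  simp only [Psi, h1, max_self]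
  constructor <;> linarith

lemma log_convex {ι : Type*} (s : Finset ι) (c k : ι → ℝ) (hc : ∀ i ∈ s, 0 ≤ c i)
    (hpos : ∀ x : ℝ, 0 < ∑ i ∈ s, c i * Real.exp (k i * x)) (u v w : ℝ) (huv : u < v)
    (hvw : v < w) :
    (w - u) * Real.log (∑ i ∈ s, c i * Real.exp (k i * v))
      ≤ (w - v) * Real.log (∑ i ∈ s, c i * Real.exp (k i * u))
      + (v - u) * Real.log (∑ i ∈ s, c i * Real.exp (k i * w)) := by
  set A := ∑ i ∈ s, c i * Real.exp (k i * u) with hA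
  set B := ∑ i ∈ s, c i * Real.exp (k i * w) with hB
  have hAp : 0 < A := hpos u
  have hBp : 0 < B := hpos w
  have hwu : 0 < w - u := by linarith
  set θ := (w - v) / (w - u) with hθ
  set η := (v - u) / (w - u) with hη
  have hθ0 : 0 ≤ θ := div_nonneg (by linarith) hwu.le
  have hη0 : 0 ≤ η := div_nonneg (by linarith) hwu.le
  have hsum : θ + η = 1 := by rw [hθ, hη, ← add_div, div_eq_one_iff_eq hwu.ne']; ring
  have hv : v = θ * u + η * w := by rw [hθ, hη]; field_simp; ring
  have key : ∑ i ∈ s, c i * Real.exp (k i * v)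
      ≤ Real.exp (θ * Real.log A + η * Real.log B) := by
    have h1 : ∀ i ∈ s, c i * Real.exp (k i * v) ≤ Real.exp (θ * Real.log A + η * Real.log B) *
        (θ / A * (c i * Real.exp (k i * u)) + η / B * (c i * Real.exp (k i * w))) := by
      intro i hi
      have hcv := convexOn_exp.2 (Set.mem_univ (k i * u - Real.log A))
        (Set.mem_univ (k i * w - Real.log B)) hθ0 hη0 hsum
      simp only [smul_eq_mul] at hcv
      have e1 : Real.exp (k i * v) = Real.exp (θ * Real.log A + η * Real.log B) *
          Real.exp (θ * (k i * u - Real.log A) + η * (k i * w - Real.log B)) := by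
        rw [← Real.exp_add]; congr 1; rw [hv]; ring
      rw [Real.exp_sub, Real.exp_sub, Real.exp_log hAp, Real.exp_log hBp] at hcv
      rw [e1]
      have h2 := mul_le_mul_of_nonneg_left hcv
        (mul_nonneg (hc i hi) (Real.exp_pos (θ * Real.log A + η * Real.log B)).le)
      refine le_trans (le_of_eq ?_) (h2.trans (le_of_eq ?_)) <;> ring
    refine (Finset.sum_le_sum h1).trans (le_of_eq ?_)
    rw [← Finset.mul_sum, Finset.sum_add_distrib, ← Finset.mul_sum, ← Finset.mul_sum, ← hA, ← hB,
      div_mul_cancel₀ _ hAp.ne', div_mul_cancel₀ _ hBp.ne', hsum, mul_one]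
  have h3 := Real.log_le_log (hpos v) key
  rw [Real.log_exp] at h3
  have h4 := mul_le_mul_of_nonneg_left h3 hwu.le
  refine h4.trans (le_of_eq ?_)
  rw [hθ, hη]; field_simp

lemma Pset_nonempty (n : ℕ) (hn : 2 ≤ n) : (Pset n).Nonempty := by
  have key : ∀ m, 1 ≤ m → 0 < PS (2 * m) 1 (2 ^ 2) := by
    intro m hm
    obtain ⟨k, rfl⟩ : ∃ k, m = k + 1 := ⟨m - 1, by omega⟩
    have h1 := Rh_pulled k 1 2 le_rfl (by norm_num)
    have h2 : 0 < Rh (k + 1) 1 2 := lt_of_lt_of_le (by norm_num) h1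
    have h3 := glue_bound (k + 1) 1 2 le_rfl (by norm_num)
    have h4 : 0 < Rh (k + 1) 1 2 ^ 2 := by positivity
    by_contra hcon
    push Not at hcon
    have : (((k + 1 : ℕ) : ℝ) + 1) * ((2 * ((k + 1 : ℕ) : ℝ) + 1) * (2 * ((k + 1 : ℕ) : ℝ) + 1))
      * (1 * PS (2 * (k + 1)) 1 (2 ^ 2)) ≤ 0 :=
      mul_nonpos_of_nonneg_of_nonpos (by positivity) (by linarith)
    linarith
  have pos : 0 < PS n 1 (2 ^ 2) := by
    rcases Nat.even_or_odd' n with ⟨m, rfl | rfl⟩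
    · exact key m (by omega)
    · obtain ⟨k, rfl⟩ : ∃ k, m = k + 1 := ⟨m - 1, by omega⟩
      have := PS_odd (2 * k + 1) (by omega) (by omega) 1 (2 ^ 2) (by norm_num) (by norm_num)
      exact lt_of_lt_of_le (key (k + 1) (by omega)) this
  rw [PS_eq] at pos
  by_contra h
  rw [Finset.not_nonempty_iff_eq_empty] at h
  rw [h, Finset.sum_empty] at pos
  exact lt_irrefl _ pos

lemma PS_pos (n : ℕ) (hn : 2 ≤ n) (a y : ℝ) (ha : 0 < a) (hy : 0 < y) : 0 < PS n a y := by
  rw [PS_eq]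
  apply Finset.sum_pos _ (Pset_nonempty n hn)
  intro X _
  exact mul_pos (pow_pos ha _) (zpow_pos hy _)

lemma conv_y (n : ℕ) (hn : 2 ≤ n) (a : ℝ) (ha : 0 < a) (u v w : ℝ) (huv : u < v) (hvw : v < w) :
    (w - u) * Real.log (PS n a (Real.exp v)) ≤ (w - v) * Real.log (PS n a (Real.exp u))
      + (v - u) * Real.log (PS n a (Real.exp w)) := by
  have e : ∀ x, PS n a (Real.exp x) = ∑ X ∈ Pset n, a ^ visits ((X.1 : ℕ) : ℤ) X.2.2 *
      Real.exp (((hgt ((X.1 : ℕ) : ℤ) X.2.1 (n / 2) : ℤ) : ℝ) * x) := by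
    intro x
    rw [PS_eq]
    apply Finset.sum_congr rfl
    intro X _
    rw [Pw, mul_comm _ x, Real.exp_mul, Real.rpow_intCast]
  rw [e, e, e]
  apply log_convex _ _ _ _ _ u v w huv hvw
  · intro i _; positivity
  · intro x; rw [← e]; exact PS_pos n hn a _ ha (Real.exp_pos _)

lemma conv_a (n : ℕ) (hn : 2 ≤ n) (y : ℝ) (hy : 0 < y) (u v w : ℝ) (huv : u < v) (hvw : v < w) :
    (w - u) * Real.log (PS n (Real.exp v) y) ≤ (w - v) * Real.log (PS n (Real.exp u) y)
      + (v - u) * Real.log (PS n (Real.exp w) y) := by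
  have e : ∀ x, PS n (Real.exp x) y = ∑ X ∈ Pset n, y ^ hgt ((X.1 : ℕ) : ℤ) X.2.1 (n / 2) *
      Real.exp (((visits ((X.1 : ℕ) : ℤ) X.2.2 : ℕ) : ℝ) * x) := by
    intro x
    rw [PS_eq]
    apply Finset.sum_congr rfl
    intro X _
    rw [Pw, Real.exp_nat_mul, mul_comm]
  rw [e, e, e]
  apply log_convex _ _ _ _ _ u v w huv hvw
  · intro i _; positivity
  · intro x; rw [← e]; exact PS_pos n hn _ y (Real.exp_pos _) hy

lemma err_tendsto (D : ℝ) (hD : 0 < D) (k : ℕ) :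
    Tendsto (fun n : ℕ => Real.log (D * (n + 1) ^ k) / (2 * n)) atTop (nhds 0) := by
  have h1 : Tendsto (fun n : ℕ => Real.log ((n : ℝ) + 1) / ((n : ℝ) + 1)) atTop (nhds 0) := by
    have := (Real.isLittleO_log_id_atTop.tendsto_div_nhds_zero).comp
      (tendsto_atTop_add_const_right atTop (1 : ℝ) (tendsto_natCast_atTop_atTop (R := ℝ)))
    exact this
  have h2 : Tendsto (fun n : ℕ => 1 / (n : ℝ)) atTop (nhds 0) := tendsto_one_div_atTop_nhds_zero_nat
  have h3 : Tendsto (fun n : ℕ => (Real.log D / 2) * (1 / (n : ℝ)) +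
      (k / 2) * ((Real.log ((n : ℝ) + 1) / ((n : ℝ) + 1)) * (1 + 1 / (n : ℝ)))) atTop
      (nhds ((Real.log D / 2) * 0 + (k / 2) * (0 * (1 + 0)))) :=
    (h2.const_mul _).add ((h1.mul (h2.const_add 1)).const_mul _)
  simp only [mul_zero, zero_mul, add_zero] at h3
  refine h3.congr' ?_
  filter_upwards [eventually_gt_atTop 0] with n hn
  have hn' : (0 : ℝ) < n := by exact_mod_cast hn
  rw [Real.log_mul hD.ne' (by positivity), Real.log_pow]
  field_simp

/-- the finite-size free energy -/
noncomputable def fE (a y : ℝ) (n : ℕ) : ℝ := Real.log (PS n a y) / (2 * n)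

lemma Psi_sqrt (a y : ℝ) : 0 < max y 1 ∧ 0 < max (max y 1) (a - 1) :=
  ⟨lt_of_lt_of_le one_pos (le_max_right _ _),
    lt_of_lt_of_le one_pos ((le_max_right y 1).trans (le_max_left _ _))⟩

lemma fE_upper (a y : ℝ) (ha : 0 < a) (hy : 0 < y) (ε : ℝ) (hε : 0 < ε) :
    ∀ᶠ n in atTop, fE a y n ≤ Psi a y + ε := by
  obtain ⟨m1, m2⟩ := Psi_sqrt a y
  set p := Real.sqrt (max y 1) with hp
  set q := Real.sqrt (max (max y 1) (a - 1)) with hq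
  have hp1 : 1 ≤ p := by rw [hp, Real.one_le_sqrt]; exact le_max_right _ _
  have hpq : p ≤ q := Real.sqrt_le_sqrt (le_max_left _ _)
  have hp2 : p ^ 2 = max y 1 := Real.sq_sqrt m1.le
  have hq2 : q ^ 2 = max (max y 1) (a - 1) := Real.sq_sqrt m2.le
  have hq1 : 1 ≤ q := hp1.trans hpq
  have hD : 0 < (q ^ 2 + 1) * q ^ 2 := by positivity
  have hP : Psi a y = Real.log ((p + p⁻¹) * (q + q⁻¹)) / 2 := by
    rw [Real.log_mul (by positivity) (by positivity)]; rfl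
  filter_upwards [(err_tendsto _ hD 2).eventually (gt_mem_nhds hε), eventually_ge_atTop 2]
    with n hn hn2
  have hn0 : (0 : ℝ) < n := by exact_mod_cast (by omega : 0 < n)
  have h := PS_upper n a y p q ha hy hp1 hpq (hp2 ▸ le_max_left _ _)
    (by rw [hq2]; linarith [le_max_right (max y 1) (a - 1)])
  have h2 := Real.log_le_log (PS_pos n hn2 a y ha hy) h
  rw [Real.log_mul (by positivity) (by positivity), Real.log_pow] at h2
  rw [fE, hP]
  have h3 : Real.log (PS n a y) / (2 * n) ≤ (Real.log ((q ^ 2 + 1) * q ^ 2 * (n + 1) ^ 2) +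
      n * Real.log ((p + p⁻¹) * (q + q⁻¹))) / (2 * n) := by gcongr
  rw [add_div] at h3
  have h4 : n * Real.log ((p + p⁻¹) * (q + q⁻¹)) / (2 * n)
      = Real.log ((p + p⁻¹) * (q + q⁻¹)) / 2 := by field_simp
  linarith

lemma lower_even (Λ C a p : ℝ) (hC : 0 < C) (ha : 1 ≤ a) (hp : 0 < p) (hΛ : 1 ≤ Λ)
    (h : ∀ k : ℕ, Λ ^ k ≤ C * Rh (k + 1) a p) (k : ℕ) :
    Λ ^ (2 * k) ≤ C ^ 2 * a * ((2 * (k + 1 : ℕ) : ℕ) + 1) ^ 3 * PS (2 * (k + 1)) a (p ^ 2) := by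
  have h1 : Λ ^ (2 * k) ≤ C ^ 2 * (Rh (k + 1) a p) ^ 2 := by
    rw [mul_comm 2 k, pow_mul, ← mul_pow]
    have : 0 ≤ Λ ^ k := by positivity
    exact pow_le_pow_left₀ this (h k) 2
  have hP := PS_pos (2 * (k + 1)) (by omega) a (p ^ 2) (by linarith) (by positivity)
  have h2 := glue_bound (k + 1) a p ha hp
  have h3 : ((k + 1 : ℕ) + 1 : ℝ) * ((2 * (k + 1 : ℕ) + 1) * (2 * (k + 1 : ℕ) + 1))
      ≤ ((2 * (k + 1 : ℕ) : ℕ) + 1) ^ 3 := by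
    push_cast
    have : (0 : ℝ) ≤ k := by positivity
    nlinarith [mul_nonneg this (sq_nonneg (2 * ((k : ℝ) + 1) + 1))]
  calc _ ≤ _ := h1
    _ ≤ C ^ 2 * (((2 * (k + 1 : ℕ) : ℕ) + 1) ^ 3 * (a * PS (2 * (k + 1)) a (p ^ 2))) := by
      apply mul_le_mul_of_nonneg_left _ (by positivity)
      refine h2.trans ?_
      exact mul_le_mul_of_nonneg_right h3 (by positivity)
    _ = _ := by ring

lemma lower_all (Λ C a p : ℝ) (hC : 0 < C) (ha : 1 ≤ a) (hp : 0 < p) (hΛ : 1 ≤ Λ)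
    (h : ∀ k : ℕ, Λ ^ k ≤ C * Rh (k + 1) a p) (n : ℕ) (hn : 2 ≤ n) :
    Λ ^ n ≤ (Λ ^ 3 * (C ^ 2 * a)) * (n + 1) ^ 3 * PS n a (p ^ 2) := by
  have ha0 : 0 < a := by linarith
  have hy : 0 < p ^ 2 := by positivity
  obtain ⟨k, hk⟩ : ∃ k, n = 2 * (k + 1) ∨ n = 2 * (k + 1) + 1 := ⟨n / 2 - 1, by omega⟩
  have h0 := lower_even Λ C a p hC ha hp hΛ h k
  have hP := PS_pos (2 * (k + 1)) (by omega) a (p ^ 2) ha0 hy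
  rcases hk with rfl | rfl
  · have e : Λ ^ (2 * (k + 1)) = Λ ^ 2 * Λ ^ (2 * k) := by ring
    rw [e]
    calc _ ≤ Λ ^ 3 * (C ^ 2 * a * ((2 * (k + 1 : ℕ) : ℕ) + 1) ^ 3
          * PS (2 * (k + 1)) a (p ^ 2)) := by
          apply mul_le_mul _ h0 (by positivity) (by positivity)
          exact pow_le_pow_right₀ hΛ (by norm_num)
      _ = _ := by ring
  · have e : Λ ^ (2 * (k + 1) + 1) = Λ ^ 3 * Λ ^ (2 * k) := by ring
    rw [e]
    have ho := PS_odd (2 * k + 1) (by omega) (by omega) a (p ^ 2) ha0 hy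
    have ho' : PS (2 * (k + 1)) a (p ^ 2) ≤ PS (2 * (k + 1) + 1) a (p ^ 2) := ho
    have hP' := hP.trans_le ho'
    calc _ ≤ Λ ^ 3 * (C ^ 2 * a * ((2 * (k + 1 : ℕ) : ℕ) + 1) ^ 3
          * PS (2 * (k + 1)) a (p ^ 2)) := by
          apply mul_le_mul_of_nonneg_left h0 (by positivity)
      _ ≤ Λ ^ 3 * (C ^ 2 * a * ((2 * (k + 1 : ℕ) + 1 : ℕ) + 1) ^ 3
          * PS (2 * (k + 1) + 1) a (p ^ 2)) := by
          apply mul_le_mul_of_nonneg_left _ (by positivity)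
          apply mul_le_mul _ ho' hP.le (by positivity)
          apply mul_le_mul_of_nonneg_left _ (by positivity)
          apply pow_le_pow_left₀ (by positivity)
          push_cast; linarith
      _ = _ := by ring

lemma fE_lower (Λ C a p : ℝ) (hC : 0 < C) (ha : 1 ≤ a) (hp : 0 < p) (hΛ : 1 ≤ Λ)
    (h : ∀ k : ℕ, Λ ^ k ≤ C * Rh (k + 1) a p) (ε : ℝ) (hε : 0 < ε) :
    ∀ᶠ n in atTop, Real.log Λ / 2 - ε ≤ fE a (p ^ 2) n := by
  have ha0 : 0 < a := by linarith
  have hy : 0 < p ^ 2 := by positivity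
  have hΛ0 : 0 < Λ := by linarith
  have hD : 0 < Λ ^ 3 * (C ^ 2 * a) := by positivity
  filter_upwards [(err_tendsto _ hD 3).eventually (gt_mem_nhds hε), eventually_ge_atTop 2]
    with n hn hn2
  have hn0 : (0 : ℝ) < n := by exact_mod_cast (by omega : 0 < n)
  have h1 := lower_all Λ C a p hC ha hp hΛ h n hn2
  have hP := PS_pos n hn2 a (p ^ 2) ha0 hy
  have h2 := Real.log_le_log (by positivity) h1
  rw [Real.log_mul (by positivity) hP.ne', Real.log_pow] at h2
  have h3 : n * Real.log Λ / (2 * n) ≤ (Real.log (Λ ^ 3 * (C ^ 2 * a) * (n + 1) ^ 3) +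
      Real.log (PS n a (p ^ 2))) / (2 * n) := by gcongr
  rw [add_div] at h3
  have h4 : n * Real.log Λ / (2 * n) = Real.log Λ / 2 := by field_simp
  rw [fE]
  linarith

lemma fE_tendsto_of (a y : ℝ) (ha : 0 < a) (hy : 0 < y)
    (h : ∀ ε > 0, ∀ᶠ n in atTop, Psi a y - ε ≤ fE a y n) :
    Tendsto (fE a y) atTop (nhds (Psi a y)) := by
  rw [Metric.tendsto_nhds]
  intro ε hε
  filter_upwards [h (ε / 2) (by linarith), fE_upper a y ha hy (ε / 2) (by linarith)] with n h1 h2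
  rw [Real.dist_eq, abs_lt]
  constructor <;> linarith

lemma two_le_lam (s : ℝ) (hs : 1 ≤ s) : 2 ≤ s + s⁻¹ := by
  have := lam_mono 1 s le_rfl hs
  norm_num at this
  linarith

lemma fE_tendsto_big (a y : ℝ) (ha : 1 ≤ a) (hy : 1 < y) :
    Tendsto (fE a y) atTop (nhds (Psi a y)) := by
  have hy0 : 0 < y := by linarith
  apply fE_tendsto_of a y (by linarith) hy0
  intro ε hε
  have hp1 : 1 < Real.sqrt y := by rw [Real.lt_sqrt]; simpa using hy; norm_num
  have hp2 : Real.sqrt y ^ 2 = y := Real.sq_sqrt hy0.le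
  set p := Real.sqrt y with hp
  have hp0 : 0 < p := by linarith
  have l1 := two_le_lam p hp1.le
  have m : max y 1 = y := max_eq_left hy.le
  rcases le_or_gt a (y + 1) with hay | hay
  · have hd : 0 < p ^ (2 : ℤ) - p ^ (-2 : ℤ) := by
      have : p ^ (-2 : ℤ) < p ^ (2 : ℤ) := zpow_lt_zpow_right₀ hp1 (by norm_num)
      linarith
    have := fE_lower ((p + p⁻¹) ^ 2) (1 / (p ^ (2 : ℤ) - p ^ (-2 : ℤ))) a p (by positivity) ha hp0
      (by nlinarith) (fun k => by
        have := Rh_pulled k a p ha hp1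
        rw [one_div, ← div_eq_inv_mul, le_div_iff₀ hd]
        exact this) ε hε
    rw [hp2] at this
    have e : Psi a y = Real.log ((p + p⁻¹) ^ 2) / 2 := by
      rw [Psi, m, max_eq_left (by linarith : a - 1 ≤ y), Real.log_pow, ell]
      push_cast; ring
    rw [e]; exact this
  · have hq2 : Real.sqrt (a - 1) ^ 2 = a - 1 := Real.sq_sqrt (by linarith)
    have hpq : p < Real.sqrt (a - 1) := Real.sqrt_lt_sqrt hy0.le (by linarith)
    set q := Real.sqrt (a - 1) with hq
    obtain ⟨C, hC, h⟩ := Rh_adsorbed p q hp1 hpq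
    rw [hq2, sub_add_cancel] at h
    have l2 := two_le_lam q (by linarith)
    have := fE_lower ((p + p⁻¹) * (q + q⁻¹)) C a p hC ha hp0 (by nlinarith) h ε hε
    rw [hp2] at this
    have e : Psi a y = Real.log ((p + p⁻¹) * (q + q⁻¹)) / 2 := by
      rw [Psi, m, max_eq_right (by linarith : y ≤ a - 1),
        Real.log_mul (by positivity) (by linarith), ell, ell]
    rw [e]; exact this

lemma fE_conv_y (n : ℕ) (hn : 2 ≤ n) (a : ℝ) (ha : 0 < a) (u v w : ℝ) (huv : u < v) (hvw : v < w) :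
    (w - u) * fE a (Real.exp v) n ≤ (w - v) * fE a (Real.exp u) n
      + (v - u) * fE a (Real.exp w) n := by
  have hn0 : (0 : ℝ) < n := by exact_mod_cast (by omega : 0 < n)
  have h := conv_y n hn a ha u v w huv hvw
  simp only [fE]
  rw [← mul_div_assoc, ← mul_div_assoc, ← mul_div_assoc, ← add_div]
  gcongr

lemma fE_conv_a (n : ℕ) (hn : 2 ≤ n) (y : ℝ) (hy : 0 < y) (u v w : ℝ) (huv : u < v) (hvw : v < w) :
    (w - u) * fE (Real.exp v) y n ≤ (w - v) * fE (Real.exp u) y n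
      + (v - u) * fE (Real.exp w) y n := by
  have hn0 : (0 : ℝ) < n := by exact_mod_cast (by omega : 0 < n)
  have h := conv_a n hn y hy u v w huv hvw
  simp only [fE]
  rw [← mul_div_assoc, ← mul_div_assoc, ← mul_div_assoc, ← add_div]
  gcongr

lemma fE_tendsto_gt (a y : ℝ) (ha : 0 < a) (hy : 1 < y) :
    Tendsto (fE a y) atTop (nhds (Psi a y)) := by
  rcases le_or_gt 1 a with h1 | h1
  · exact fE_tendsto_big a y h1 hy
  apply fE_tendsto_of a y ha (by linarith)
  intro ε hε
  have hP : ∀ b : ℝ, b ≤ 2 → Psi b y = ell y := by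
    intro b hb
    rw [Psi, max_eq_left hy.le, max_eq_left (by linarith)]; ring
  have t1 := fE_tendsto_big 1 y le_rfl hy
  have t2 := fE_tendsto_big 2 y (by norm_num) hy
  rw [hP 1 (by norm_num)] at t1
  rw [hP 2 le_rfl] at t2
  rw [hP a (by linarith)]
  have hw : 0 < Real.log 2 := Real.log_pos (by norm_num)
  have hu : Real.log a < 0 := Real.log_neg ha h1
  have t := ((t1.const_mul (Real.log 2 - Real.log a)).add (t2.const_mul (Real.log a))).div_const
    (Real.log 2)
  have e : ((Real.log 2 - Real.log a) * ell y + Real.log a * ell y) / Real.log 2 = ell y := by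
    field_simp; ring
  rw [e] at t
  filter_upwards [t.eventually (lt_mem_nhds (sub_lt_self _ hε)), eventually_ge_atTop 2]
    with n h2 hn
  have h3 := fE_conv_a n hn y (by linarith) (Real.log a) 0 (Real.log 2) hu hw
  rw [Real.exp_log ha, Real.exp_zero, Real.exp_log (by norm_num)] at h3
  refine h2.le.trans ?_
  rw [div_le_iff₀ hw]
  linarith

lemma fE_tendsto_le (a y : ℝ) (ha : 0 < a) (hy : 0 < y) (hy1 : y ≤ 1) :
    Tendsto (fE a y) atTop (nhds (Psi a y)) := by
  apply fE_tendsto_of a y ha hy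
  intro ε hε
  have hP : Psi a y = Psi a 1 := by
    rw [Psi, Psi, max_eq_right hy1, max_self]
  rw [hP]
  obtain ⟨x, rfl⟩ : ∃ x, y = Real.exp x := ⟨Real.log y, (Real.exp_log hy).symm⟩
  have hx : x ≤ 0 := by simpa using hy1
  obtain ⟨δ, hδ, hδ1, hδ2⟩ : ∃ δ : ℝ, 0 < δ ∧ δ ≤ 1 ∧ δ * (1 - x) ≤ ε := by
    have hx1 : 0 < 1 - x := by linarith
    refine ⟨min 1 (ε / (1 - x)), by positivity, min_le_left _ _, ?_⟩
    rw [← le_div_iff₀ hx1]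
    exact min_le_right _ _
  have t1 := fE_tendsto_gt a (Real.exp δ) ha (by simpa using hδ)
  have t2 := fE_tendsto_gt a (Real.exp (2 * δ)) ha (by simpa using hδ)
  have t := ((t1.const_mul (2 * δ - x)).sub (t2.const_mul (δ - x))).div_const δ
  have b1 := (Psi_bounds a δ hδ.le).1
  have b2 := (Psi_bounds a (2 * δ) (by linarith)).2
  have hlt : Psi a 1 - ε < ((2 * δ - x) * Psi a (Real.exp δ)
      - (δ - x) * Psi a (Real.exp (2 * δ))) / δ := by
    rw [lt_div_iff₀ hδ]
    have c1 := mul_le_mul_of_nonneg_left b1 (by linarith : 0 ≤ 2 * δ - x)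
    have c2 := mul_le_mul_of_nonneg_left b2 (by linarith : 0 ≤ δ - x)
    have c3 : (δ - x) * δ ≤ ε := le_trans (by nlinarith) hδ2
    have c4 : (δ - x) * δ * δ ≤ ε * δ := mul_le_mul_of_nonneg_right c3 hδ.le
    have c5 : 0 < ε * δ := by positivity
    nlinarith
  filter_upwards [t.eventually (lt_mem_nhds hlt), eventually_ge_atTop 2] with n h2 hn
  have h3 := fE_conv_y n hn a ha x δ (2 * δ) (by linarith) (by linarith)
  refine h2.le.trans ?_
  rw [div_le_iff₀ hδ]
  linarith

lemma Psi_formula (a y : ℝ) (ha : 0 < a) (hy : 0 < y) :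
    Psi a y = (if y ≤ 1 then
            (if a ≤ 2 then Real.log 2
             else (1/2) * Real.log 2 + (1/2) * Real.log a - (1/4) * Real.log (a-1))
          else
            (if a ≤ y + 1 then Real.log (y+1) - (1/2) * Real.log y
             else (1/2) * Real.log a - (1/4) * Real.log (a-1)
                  + (1/2) * Real.log (y+1) - (1/4) * Real.log y)) := by
  have e1 : ell 1 = Real.log 2 := by rw [ell]; norm_num
  split_ifs with h1 h2 h2
  · rw [Psi, max_eq_right h1, max_eq_left (by linarith), e1]; ring
  · rw [Psi, max_eq_right h1, max_eq_right (by linarith), e1, ell_eq _ (by linarith),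
      sub_add_cancel]; ring
  · rw [Psi, max_eq_left (by linarith), max_eq_left (by linarith), ell_eq _ hy]; ring
  · rw [Psi, max_eq_left (by linarith), max_eq_right (by linarith), ell_eq _ hy,
      ell_eq _ (by linarith), sub_add_cancel]; ring

/-- Theorem 3 (`ψ^S`): the free energy of all half-space staircase polygons exists and
equals `ψ^C(a,y)`. -/
theorem psiS_exists (a y : ℝ) (ha : 0 < a) (hy : 0 < y) :
    Tendsto (fun n : ℕ => Real.log (PS n a y) / (2 * n)) atTop
      (nhds (if y ≤ 1 then
            (if a ≤ 2 then Real.log 2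
             else (1/2) * Real.log 2 + (1/2) * Real.log a - (1/4) * Real.log (a-1))
          else
            (if a ≤ y + 1 then Real.log (y+1) - (1/2) * Real.log y
             else (1/2) * Real.log a - (1/4) * Real.log (a-1)
                  + (1/2) * Real.log (y+1) - (1/4) * Real.log y))) := by
  rw [← Psi_formula a y ha hy]
  rcases le_or_gt y 1 with h | h
  · exact fE_tendsto_le a y ha hy h
  · exact fE_tendsto_gt a y ha h
end

section
/- For integers n ≥ 0 and 0 ≤ m ≤ k ≤ n with k ≡ m ≡ n (mod 2), the number s¹_n(k,m) of pairs of nonintersecting binomial paths satisfies s¹_n(k,m) = [(k+3)(m+1)(k−m+2)(k+m+4) / (4(n+1)(n+2)(n+3)²)] · binom(n+3, (n+k+6)/2) · binom(n+3, (n+m+4)/2), where binom(N, j) is taken to be 0 if (n+k+6)/2 > n+3. -/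
open Finset Filter

attribute [local instance] Classical.propDecidable

/-- `s¹_n(k,m)`: the number of pairs `(σ, τ)` of binomial paths of length `n` in the
upper half-plane, with `σ` from `(0,0)` to `(n,m)`, `τ` from `(0,2)` to `(n,k+2)`, and
the second coordinate of `τᵢ` strictly greater than that of `σᵢ` for all `0 ≤ i ≤ n`. -/
noncomputable def s1Count (n k m : ℕ) : ℕ :=
  ((Finset.univ : Finset ((Fin n → Bool) × (Fin n → Bool))).filter
    (fun p => InUHP 0 p.1 ∧ InUHP 2 p.2 ∧ (∀ i ≤ n, hgt 0 p.1 i < hgt 2 p.2 i) ∧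
      hgt 0 p.1 n = (m : ℤ) ∧ hgt 2 p.2 n = (k : ℤ) + 2)).card

namespace S1Aux

/-- Sign of a step. -/
def eps (x : Bool) : ℤ := if x then 1 else -1

lemma hgt_snoc_le {n : ℕ} (c : ℤ) (s : Fin n → Bool) (x : Bool) (i : ℕ) (hi : i ≤ n) :
    hgt c (Fin.snoc (α := fun _ => Bool) s x : Fin (n + 1) → Bool) i = hgt c s i := by
  unfold hgt
  congr 1
  apply Finset.sum_congr rfl
  intro j hj
  have hj' : j < n := by have := Finset.mem_range.1 hj; omega
  have hj2 : j < n + 1 := by omega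
  simp [hj', hj2, Fin.snoc]

lemma hgt_snoc_last {n : ℕ} (c : ℤ) (s : Fin n → Bool) (x : Bool) :
    hgt c (Fin.snoc (α := fun _ => Bool) s x : Fin (n + 1) → Bool) (n + 1) =
      hgt c s n + eps x := by
  rw [← hgt_snoc_le c s x n le_rfl]
  unfold hgt
  rw [Finset.sum_range_succ]
  simp [Fin.snoc, eps, add_assoc]

lemma sum_snoc {n : ℕ} (f : (Fin (n + 1) → Bool) → ℤ) :
    ∑ s, f s = ∑ s : Fin n → Bool, (f (Fin.snoc (α := fun _ => Bool) s true)
      + f (Fin.snoc (α := fun _ => Bool) s false)) := by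
  rw [← (Fin.snocEquiv (fun _ : Fin (n + 1) => Bool)).sum_comp, Fintype.sum_prod_type,
    Finset.sum_comm]
  apply Finset.sum_congr rfl
  intro s _
  simp [Fin.snocEquiv]

/-- The constraint on a pair of paths. -/
def Good {n : ℕ} (s t : Fin n → Bool) : Prop :=
  ∀ i ≤ n, 0 ≤ hgt 0 s i ∧ 0 ≤ hgt 2 t i ∧ hgt 0 s i < hgt 2 t i

/-- Number of constrained pairs with given ends. -/
noncomputable def cnt (n : ℕ) (a b : ℤ) : ℤ :=
  ∑ s : Fin n → Bool, ∑ t : Fin n → Bool,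
    if Good s t ∧ hgt 0 s n = a ∧ hgt 2 t n = b then 1 else 0

lemma s1Count_eq (n k m : ℕ) : (s1Count n k m : ℤ) = cnt n m (k + 2) := by
  unfold s1Count cnt
  rw [Finset.card_filter, Fintype.sum_prod_type]
  push_cast
  refine Finset.sum_congr rfl fun s _ => Finset.sum_congr rfl fun t _ => ?_
  apply if_congr _ rfl rfl
  unfold Good InUHP
  grind

lemma cnt_boundary (n : ℕ) (a b : ℤ) (h : a < 0 ∨ b ≤ a) : cnt n a b = 0 := by
  unfold cnt
  refine Finset.sum_eq_zero fun s _ => Finset.sum_eq_zero fun t _ => ?_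
  rw [if_neg]
  rintro ⟨h1, h2, h3⟩
  have := h1 n le_rfl
  omega

lemma good_snoc {n : ℕ} (s t : Fin n → Bool) (x y : Bool) (a b : ℤ) (ha : 0 ≤ a) (hab : a < b) :
    (Good (Fin.snoc (α := fun _ => Bool) s x : Fin (n + 1) → Bool)
        (Fin.snoc (α := fun _ => Bool) t y) ∧
      hgt 0 (Fin.snoc (α := fun _ => Bool) s x : Fin (n + 1) → Bool) (n + 1) = a ∧
      hgt 2 (Fin.snoc (α := fun _ => Bool) t y : Fin (n + 1) → Bool) (n + 1) = b) ↔
    (Good s t ∧ hgt 0 s n = a - eps x ∧ hgt 2 t n = b - eps y) := by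
  have e1 := hgt_snoc_last 0 s x
  have e2 := hgt_snoc_last 2 t y
  constructor
  · rintro ⟨h1, h2, h3⟩
    refine ⟨fun i hi => ?_, by omega, by omega⟩
    have := h1 i (by omega)
    rwa [hgt_snoc_le _ _ _ _ hi, hgt_snoc_le _ _ _ _ hi] at this
  · rintro ⟨h1, h2, h3⟩
    refine ⟨fun i hi => ?_, by omega, by omega⟩
    rcases Nat.lt_or_ge n i with h | h
    · have : i = n + 1 := by omega
      subst this
      omega
    · rw [hgt_snoc_le _ _ _ _ h, hgt_snoc_le _ _ _ _ h]
      exact h1 i h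

lemma cnt_succ (n : ℕ) (a b : ℤ) (ha : 0 ≤ a) (hab : a < b) :
    cnt (n + 1) a b = cnt n (a - 1) (b - 1) + cnt n (a - 1) (b + 1)
      + cnt n (a + 1) (b - 1) + cnt n (a + 1) (b + 1) := by
  unfold cnt
  rw [sum_snoc]
  simp_rw [sum_snoc, good_snoc _ _ _ _ a b ha hab]
  simp only [eps, Finset.sum_add_distrib]
  simp
  ring

/-- Number of unconstrained paths. -/
def w : ℕ → ℤ → ℤ
  | 0, x => if x = 0 then 1 else 0
  | n + 1, x => w n (x - 1) + w n (x + 1)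

lemma w_neg (n : ℕ) : ∀ x, w n (-x) = w n x := by
  induction n with
  | zero => intro x; simp [w]
  | succ n ih =>
    intro x
    simp only [w]
    rw [← ih (x - 1), ← ih (x + 1), add_comm]
    congr 2 <;> ring

lemma w_zero (n : ℕ) : ∀ x : ℤ, (n : ℤ) < x → w n x = 0 := by
  induction n with
  | zero => intro x hx; simp [w]; simp at hx; omega
  | succ n ih =>
    intro x hx
    push_cast at hx
    simp only [w]
    rw [ih _ (by omega), ih _ (by omega)]; rfl

lemma w_choose (n : ℕ) : ∀ p : ℕ, w n (2 * p - n) = n.choose p := by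
  induction n with
  | zero => intro p; cases p <;> simp [w]; omega
  | succ n ih =>
    intro p
    simp only [w]
    cases p with
    | zero =>
      have h1 := ih 0
      have h2 := w_zero n (n + 2) (by omega)
      rw [← w_neg] at h2
      rw [Nat.cast_zero] at *
      rw [Nat.cast_succ]
      rw [show (2 * 0 - ((n : ℤ) + 1) - 1) = -(n + 2) by ring, h2,
        show (2 * 0 - ((n : ℤ) + 1) + 1) = 2 * 0 - n by ring, h1]
      simp
    | succ p =>
      have h1 := ih p
      have h2 := ih (p + 1)
      rw [Nat.choose_succ_succ]
      push_cast at *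
      rw [← h1, ← h2]
      congr 2 <;> ring

/-- Reflected path count from height `c`. -/
def g (c : ℤ) (n : ℕ) (x : ℤ) : ℤ := w n (x - c) - w n (x + c + 2)

lemma g_succ (c : ℤ) (n : ℕ) (x : ℤ) : g c (n + 1) x = g c n (x - 1) + g c n (x + 1) := by
  simp only [g, w]
  ring_nf

lemma g_neg_one (c : ℤ) (n : ℕ) : g c n (-1) = 0 := by
  simp only [g]
  rw [← w_neg]
  ring_nf

lemma cnt_eq (n : ℕ) : ∀ a b : ℤ, -1 ≤ a → a ≤ b → a % 2 = n % 2 → b % 2 = n % 2 →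
    cnt n a b = g 0 n a * g 2 n b - g 0 n b * g 2 n a := by
  induction n with
  | zero =>
    intro a b ha hab h1 h2
    by_cases h : a < 0 ∨ b ≤ a
    · rw [cnt_boundary _ _ _ h]
      rcases h with h | h
      · obtain rfl : a = -1 := by omega
        simp [g_neg_one]
      · obtain rfl : a = b := by omega
        ring
    · have e : cnt 0 a b = if 0 = a ∧ 2 = b then 1 else 0 := by
        unfold cnt Good
        simp [hgt]
      rw [e]
      simp only [g, w]
      split_ifs <;> omega
  | succ n ih =>
    intro a b ha hab h1 h2
    by_cases h : a < 0 ∨ b ≤ a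
    · rw [cnt_boundary _ _ _ h]
      rcases h with h | h
      · obtain rfl : a = -1 := by omega
        simp [g_neg_one]
      · obtain rfl : a = b := by omega
        ring
    · push Not at h
      push_cast at h1 h2
      rw [cnt_succ n a b h.1 h.2, ih _ _ (by omega) (by omega) (by omega) (by omega),
        ih _ _ (by omega) (by omega) (by omega) (by omega),
        ih _ _ (by omega) (by omega) (by omega) (by omega),
        ih _ _ (by omega) (by omega) (by omega) (by omega)]
      simp only [g_succ]
      ring

lemma up1 (n p : ℕ) :
    ((n : ℝ) + 1) * n.choose p = (n + 1).choose (p + 1) * (p + 1) := by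
  exact_mod_cast Nat.add_one_mul_choose_eq n p

lemma up2 (n p : ℕ) :
    ((n : ℝ) + 1) * n.choose (p + 1) = (n + 1).choose (p + 1) * (n - p) := by
  have h1 := up1 n p
  have h2 : ((n + 1).choose (p + 1) : ℝ) = n.choose p + n.choose (p + 1) := by
    exact_mod_cast Nat.choose_succ_succ n p
  linear_combination (-1 : ℝ) * h1 - ((n : ℝ) + 1) * h2

lemma choose_ratio (n p : ℕ) (A D : ℝ) (hA : A = (n + 3).choose (p + 3))
    (hD : D = ((n : ℝ) + 1) * (n + 2) * (n + 3)) :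
    D * n.choose p = A * ((p + 1) * (p + 2) * (p + 3)) ∧
    D * n.choose (p + 1) = A * ((p + 2) * (p + 3) * (n - p)) ∧
    D * n.choose (p + 2) = A * ((p + 3) * (n - p) * (n - p - 1)) ∧
    D * n.choose (p + 3) = A * ((n - p) * (n - p - 1) * (n - p - 2)) := by
  subst hA hD
  have a1 := up1 n p
  have a2 := up2 n p
  have a3 := up2 n (p + 1)
  have a4 := up2 n (p + 2)
  have b1 := up1 (n + 1) (p + 1)
  have b2 := up2 (n + 1) (p + 1)
  have b3 := up2 (n + 1) (p + 2)
  have c1 := up1 (n + 2) (p + 2)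
  have c2 := up2 (n + 2) (p + 2)
  simp only [add_assoc, Nat.reduceAdd] at *
  push_cast at *
  generalize (n : ℝ) = N at *
  generalize (p : ℝ) = P at *
  refine ⟨?_, ?_, ?_, ?_⟩
  · linear_combination (N + 2) * (N + 3) * a1 + (N + 3) * (P + 1) * b1 + (P + 1) * (P + 2) * c1
  · linear_combination (N + 2) * (N + 3) * a2 + (N + 3) * (N - P) * b1 + (N - P) * (P + 2) * c1
  · linear_combination (N + 2) * (N + 3) * a3 + (N + 3) * (N - P - 1) * b2
      + (N - P - 1) * (N - P) * c1
  · linear_combination (N + 2) * (N + 3) * a4 + (N + 3) * (N - P - 2) * b3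
      + (N - P - 2) * (N - P - 1) * c2

lemma w_eq (n p : ℕ) (x : ℤ) (h : x = 2 * p - n) : w n x = n.choose p := by
  rw [h, w_choose]

end S1Aux

open S1Aux in
/-- The exact product formula for `s¹_n(k,m)`. -/
theorem s1Count_formula (n k m : ℕ) (hmk : m ≤ k) (hkn : k ≤ n)
    (hk : k % 2 = n % 2) (hm : m % 2 = n % 2) :
    (s1Count n k m : ℝ) =
      ((k + 3) * (m + 1) * (k - m + 2) * (k + m + 4) : ℝ)
        / (4 * (n + 1) * (n + 2) * (n + 3) ^ 2)
        * ((n + 3).choose ((n + k + 6) / 2)) * ((n + 3).choose ((n + m + 4) / 2)) := by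
  have hc : (s1Count n k m : ℤ) = _ := (s1Count_eq n k m).trans
    (cnt_eq n m (k + 2) (by omega) (by omega) (by omega) (by omega))
  obtain ⟨i, rfl⟩ : ∃ i, k = m + 2 * i := ⟨(k - m) / 2, by omega⟩
  obtain ⟨j, hj⟩ : ∃ j, n = m + 2 * i + 2 * j := ⟨(n - (m + 2 * i)) / 2, by omega⟩
  simp only [g] at hc
  rcases Nat.eq_zero_or_pos n with h0 | hpos
  · subst h0
    obtain rfl : m = 0 := by omega
    obtain rfl : i = 0 := by omega
    simp [w] at hc
    rw [hc]
    norm_num [Nat.choose]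
  obtain ⟨q, hq⟩ : ∃ q, m + i + j = q + 1 := ⟨m + i + j - 1, by omega⟩
  obtain ⟨p, hp⟩ : ∃ p, p = m + 2 * i + j := ⟨_, rfl⟩
  rw [w_eq n (q + 1) _ (by push_cast; omega), w_eq n (q + 2) _ (by push_cast; omega),
    w_eq n p _ (by push_cast; omega), w_eq n (p + 3) _ (by push_cast; omega),
    w_eq n (p + 1) _ (by push_cast; omega), w_eq n (p + 2) _ (by push_cast; omega),
    w_eq n q _ (by push_cast; omega), w_eq n (q + 3) _ (by push_cast; omega)] at hc
  have hc' := congrArg (Int.cast : ℤ → ℝ) hc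
  push_cast at hc'
  rw [show (n + (m + 2 * i) + 6) / 2 = p + 3 by omega, show (n + m + 4) / 2 = q + 3 by omega]
  obtain ⟨A, hA⟩ : ∃ A : ℝ, A = (n + 3).choose (p + 3) := ⟨_, rfl⟩
  obtain ⟨B, hB⟩ : ∃ B : ℝ, B = (n + 3).choose (q + 3) := ⟨_, rfl⟩
  obtain ⟨D, hD⟩ : ∃ D : ℝ, D = ((n : ℝ) + 1) * (n + 2) * (n + 3) := ⟨_, rfl⟩
  obtain ⟨p0, p1, p2, p3⟩ := choose_ratio n p A D hA hD
  obtain ⟨q0, q1, q2, q3⟩ := choose_ratio n q B D hB hD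
  rw [← hA, ← hB]
  have hD0 : D ≠ 0 := by rw [hD]; positivity
  have hn' : (n : ℝ) = m + 2 * i + 2 * j := by exact_mod_cast hj
  have hp' : (p : ℝ) = m + 2 * i + j := by exact_mod_cast hp
  have hq' : (q : ℝ) = m + i + j - 1 := by
    have : (m : ℝ) + i + j = q + 1 := by exact_mod_cast hq
    linarith
  have key : D ^ 2 * (s1Count n (m + 2 * i) m : ℝ) =
      (D * n.choose (q + 1) - D * n.choose (q + 2)) * (D * n.choose p - D * n.choose (p + 3))
      - (D * n.choose (p + 1) - D * n.choose (p + 2))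
        * (D * n.choose q - D * n.choose (q + 3)) := by
    rw [hc']; ring
  rw [p0, p1, p2, p3, q0, q1, q2, q3] at key
  apply mul_left_cancel₀ (pow_ne_zero 2 hD0)
  rw [key, hD]
  have hn1 : (n : ℝ) + 1 ≠ 0 := by positivity
  have hn2 : (n : ℝ) + 2 ≠ 0 := by positivity
  have hn3 : (n : ℝ) + 3 ≠ 0 := by positivity
  field_simp
  push_cast
  rw [hp', hq', hn']
  ring
end

section
/- For every even integer n ≥ 2 and all a, y > 0, the grafted-polygon partition function satisfies P^G_{2n}(a,y) = (1/a) Σ_{k=0}^{(n−2)/2} (s_{(n−2)/2}(k,0))² y^{k+2} + Σ_{k=0}^{(n−2)/2} Σ_{m=1}^{k} (s_{(n−2)/2}(k,m))² y^{k+2}. -/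
open Finset Filter

attribute [local instance] Classical.propDecidable

/-- `P^G_{2n}(a,y)`: partition function of grafted staircase polygons of length `2n`,
i.e. those whose leftmost vertex has second coordinate `1` and whose rightmost vertex
has second coordinate `1` if `n` is even and `2` if `n` is odd. -/
noncomputable def PG (n : ℕ) (a y : ℝ) : ℝ :=
  ∑ p ∈ (Finset.univ : Finset (Fin (n + 1) × (Fin n → Bool) × (Fin n → Bool))).filter
      (fun p => IsStaircase ((p.1 : ℕ) : ℤ) p.2.1 p.2.2 ∧ ((p.1 : ℕ) : ℤ) = 1 ∧
        hgt ((p.1 : ℕ) : ℤ) p.2.1 n = (if n % 2 = 0 then 1 else 2)),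
    a ^ visits ((p.1 : ℕ) : ℤ) p.2.2 * y ^ hgt ((p.1 : ℕ) : ℤ) p.2.1 (n / 2)

/-- `s_n(k,m)`: the sum, over the same pairs `(σ, τ)` as in `s1Count`, of `a` raised to
the number of vertices of the lower path `σ` with second coordinate `0`. -/
noncomputable def sW (a : ℝ) (n k m : ℕ) : ℝ :=
  ∑ p ∈ (Finset.univ : Finset ((Fin n → Bool) × (Fin n → Bool))).filter
      (fun p => InUHP 0 p.1 ∧ InUHP 2 p.2 ∧ (∀ i ≤ n, hgt 0 p.1 i < hgt 2 p.2 i) ∧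
        hgt 0 p.1 n = (m : ℤ) ∧ hgt 2 p.2 n = (k : ℤ) + 2),
    a ^ visits 0 p.1

namespace PGaux

lemma hgt_zero {n : ℕ} (c : ℤ) (s : Fin n → Bool) : hgt c s 0 = c := by simp [hgt]

lemma hgt_succ {n : ℕ} (c : ℤ) (s : Fin n → Bool) (i : ℕ) (h : i < n) :
    hgt c s (i + 1) = hgt c s i + (if s ⟨i, h⟩ then 1 else -1) := by
  simp [hgt, Finset.sum_range_succ, h, add_assoc]

lemma hgt_shift {n : ℕ} (c d : ℤ) (s : Fin n → Bool) (i : ℕ) :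
    hgt (c + d) s i = hgt c s i + d := by
  simp only [hgt]; ring

lemma hgt_base {n : ℕ} (c : ℤ) (s : Fin n → Bool) (i : ℕ) :
    hgt c s i = c + hgt 0 s i := by
  simp only [hgt]; ring

/-- first half, without the first step -/
def lft {N : ℕ} (s : Fin (2 * N + 2) → Bool) : Fin N → Bool :=
  fun j => s ⟨j + 1, by have := j.2; omega⟩

/-- reversed second half, without the last step -/
def rgt {N : ℕ} (s : Fin (2 * N + 2) → Bool) : Fin N → Bool :=
  fun j => !(s ⟨2 * N - j, by omega⟩)

/-- gluing two halves -/
def glue {N : ℕ} (b : Bool) (s t : Fin N → Bool) : Fin (2 * N + 2) → Bool :=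
  fun j => if h0 : (j : ℕ) = 0 then b
    else if h1 : (j : ℕ) ≤ N then s ⟨j - 1, by omega⟩
    else if h2 : (j : ℕ) ≤ 2 * N then !(t ⟨2 * N - j, by omega⟩)
    else !b

lemma lft_glue {N : ℕ} (b : Bool) (s t : Fin N → Bool) : lft (glue b s t) = s := by
  funext j
  have := j.2
  have h : (j : ℕ) + 1 ≤ N := by omega
  simp [lft, glue, h]

lemma rgt_glue {N : ℕ} (b : Bool) (s t : Fin N → Bool) : rgt (glue b s t) = t := by
  funext j
  have := j.2
  have h0 : ¬ (2 * N - (j : ℕ) = 0) := by omega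
  have h1 : ¬ (2 * N - (j : ℕ) ≤ N) := by omega
  have h2 : (2 * N - (j : ℕ) ≤ 2 * N) := by omega
  have h3 : 2 * N - (2 * N - (j : ℕ)) = j := by omega
  simp only [rgt, glue, h0, h1, h2, h3, dif_pos, dif_neg, not_false_eq_true, Bool.not_not]

lemma glue_eq {N : ℕ} (b : Bool) (s : Fin (2 * N + 2) → Bool)
    (h0 : s ⟨0, by omega⟩ = b) (h1 : s ⟨2 * N + 1, by omega⟩ = !b) :
    glue b (lft s) (rgt s) = s := by
  funext ⟨j, hj⟩
  simp only [glue, lft, rgt]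
  split_ifs with c0 c1 c2
  · subst c0; exact h0.symm
  · congr 2; omega
  · rw [Bool.not_not]; congr 2; omega
  · rw [← h1]; congr 2; omega

lemma glue_first {N : ℕ} (b : Bool) (s t : Fin N → Bool) :
    glue b s t ⟨0, by omega⟩ = b := by simp [glue]

lemma glue_last {N : ℕ} (b : Bool) (s t : Fin N → Bool) :
    glue b s t ⟨2 * N + 1, by omega⟩ = !b := by
  have h1 : ¬ (2 * N + 1 ≤ N) := by omega
  simp [glue, h1]

lemma hgt_lft {N : ℕ} (c : ℤ) (s : Fin (2 * N + 2) → Bool) (i : ℕ) (hi : i ≤ N) :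
    hgt c s (i + 1) = hgt (hgt c s 1) (lft s) i := by
  induction i with
  | zero => simp [hgt_zero]
  | succ i ih =>
    rw [hgt_succ c s (i + 1) (by omega), ih (by omega), hgt_succ _ (lft s) i (by omega)]
    rfl

lemma hgt_rgt {N : ℕ} (c : ℤ) (s : Fin (2 * N + 2) → Bool) (i : ℕ) (hi : i ≤ N) :
    hgt c s (2 * N + 1 - i) = hgt (hgt c s (2 * N + 1)) (rgt s) i := by
  induction i with
  | zero => simp [hgt_zero]
  | succ i ih =>
    rw [hgt_succ _ (rgt s) i (by omega), ← ih (by omega)]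
    have e : 2 * N + 1 - i = (2 * N - i) + 1 := by omega
    have e2 : 2 * N + 1 - (i + 1) = 2 * N - i := by omega
    rw [e, e2, hgt_succ c s (2 * N - i) (by omega)]
    simp only [rgt]
    rcases Bool.eq_false_or_eq_true (s ⟨2 * N - i, by omega⟩) with h | h <;> simp [h]

lemma parity {n : ℕ} (c : ℤ) (s : Fin n → Bool) (i : ℕ) (hi : i ≤ n) :
    (hgt c s i - c - i) % 2 = 0 := by
  induction i with
  | zero => simp [hgt_zero]
  | succ i ih =>
    have := ih (by omega)
    rw [hgt_succ c s i (by omega)]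
    push_cast
    split_ifs <;> omega

lemma upper {n : ℕ} (c : ℤ) (s : Fin n → Bool) (i : ℕ) (hi : i ≤ n) :
    hgt c s i ≤ c + i := by
  induction i with
  | zero => simp [hgt_zero]
  | succ i ih =>
    have := ih (by omega)
    rw [hgt_succ c s i (by omega)]
    push_cast
    split_ifs <;> omega

/-- admissible pair -/
def Good {N : ℕ} (p : (Fin N → Bool) × (Fin N → Bool)) : Prop :=
  InUHP 0 p.1 ∧ InUHP 2 p.2 ∧ (∀ i ≤ N, hgt 0 p.1 i < hgt 2 p.2 i)

lemma visits_split {N : ℕ} (s : Fin (2 * N + 2) → Bool) (h0 : hgt 1 s 1 = 0)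
    (h1 : hgt 1 s (2 * N + 1) = 0) (h2 : hgt 1 s (2 * N + 2) = 1) :
    visits 1 s + (if hgt 0 (lft s) N = 0 then 1 else 0)
      = visits 0 (lft s) + visits 0 (rgt s) := by
  have hL : visits 0 (lft s) = ∑ i ∈ range (N + 1), if hgt 1 s (i + 1) = 0 then 1 else 0 := by
    rw [visits, Finset.card_filter]
    refine Finset.sum_congr rfl fun i hi => ?_
    rw [hgt_lft 1 s i (by simp at hi; omega), h0]
  have hR : visits 0 (rgt s) = ∑ i ∈ range (N + 1), if hgt 1 s (N + i + 1) = 0 then 1 else 0 := by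
    rw [visits, Finset.card_filter, ← Finset.sum_range_reflect]
    refine Finset.sum_congr rfl fun i hi => ?_
    have hi' : i ≤ N := by simp at hi; omega
    have := hgt_rgt 1 s (N - i) (by omega)
    rw [h1] at this
    have e : 2 * N + 1 - (N - i) = N + i + 1 := by omega
    rw [e] at this
    have e3 : N + 1 - 1 - i = N - i := by omega
    rw [this, e3]
  have hV : visits 1 s = ∑ i ∈ range (N + (N + 1)), if hgt 1 s (i + 1) = 0 then 1 else 0 := by
    rw [visits, Finset.card_filter, Finset.sum_range_succ, h2, Finset.sum_range_succ', hgt_zero]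
    have e : 2 * N + 1 = N + (N + 1) := by omega
    simp [e]
  have hm : hgt 0 (lft s) N = hgt 1 s (N + 1) := by rw [hgt_lft 1 s N le_rfl, h0]
  rw [hV, Finset.sum_range_add, ← hR, hL, Finset.sum_range_succ, hm]
  ring

/-- conditions on the whole polygon in terms of the halves -/
lemma first_last {N : ℕ} (sp sm : Fin (2 * N + 2) → Bool)
    (h : IsStaircase 1 sp sm) (he : hgt 1 sp (2 * N + 2) = 1) :
    sp ⟨0, by omega⟩ = true ∧ sm ⟨0, by omega⟩ = false ∧
    sp ⟨2 * N + 1, by omega⟩ = false ∧ sm ⟨2 * N + 1, by omega⟩ = true := by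
  obtain ⟨h1, h2, -⟩ := h
  have a1 := h2 1 (by omega) (by omega)
  have a2 := h2 (2 * N + 1) (by omega) (by omega)
  have b1 := hgt_succ 1 sp 0 (by omega)
  have b2 := hgt_succ 1 sm 0 (by omega)
  have b3 : hgt 1 sp (2 * N + 2) = hgt 1 sp (2 * N + 1) +
      (if sp ⟨2 * N + 1, by omega⟩ then 1 else -1) := hgt_succ 1 sp (2 * N + 1) (by omega)
  have b4 : hgt 1 sm (2 * N + 2) = hgt 1 sm (2 * N + 1) +
      (if sm ⟨2 * N + 1, by omega⟩ then 1 else -1) := hgt_succ 1 sm (2 * N + 1) (by omega)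
  rw [hgt_zero] at b1 b2
  simp only [zero_add] at b1 b2
  generalize sp ⟨0, _⟩ = x1 at *
  generalize sm ⟨0, _⟩ = x2 at *
  generalize sp ⟨2 * N + 1, _⟩ = x3 at *
  generalize sm ⟨2 * N + 1, _⟩ = x4 at *
  cases x1 <;> cases x2 <;> cases x3 <;> cases x4 <;> simp at b1 b2 b3 b4 ⊢ <;> omega

lemma hgt_ends {N : ℕ} (sp sm : Fin (2 * N + 2) → Bool)
    (h : IsStaircase 1 sp sm) (he : hgt 1 sp (2 * N + 2) = 1) :
    hgt 1 sp 1 = 2 ∧ hgt 1 sm 1 = 0 ∧ hgt 1 sp (2 * N + 1) = 2 ∧ hgt 1 sm (2 * N + 1) = 0 := by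
  obtain ⟨f1, f2, f3, f4⟩ := first_last sp sm h he
  have b1 := hgt_succ 1 sp 0 (by omega)
  have b2 := hgt_succ 1 sm 0 (by omega)
  have b3 : hgt 1 sp (2 * N + 2) = hgt 1 sp (2 * N + 1) +
      (if sp ⟨2 * N + 1, by omega⟩ then 1 else -1) := hgt_succ 1 sp (2 * N + 1) (by omega)
  have b4 : hgt 1 sm (2 * N + 2) = hgt 1 sm (2 * N + 1) +
      (if sm ⟨2 * N + 1, by omega⟩ then 1 else -1) := hgt_succ 1 sm (2 * N + 1) (by omega)
  rw [hgt_zero, f1] at b1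
  rw [hgt_zero, f2] at b2
  rw [f3] at b3
  rw [f4] at b4
  have := h.1
  simp at b1 b2 b3 b4
  omega

lemma forward {N : ℕ} (sp sm : Fin (2 * N + 2) → Bool)
    (h : IsStaircase 1 sp sm) (he : hgt 1 sp (2 * N + 2) = 1) :
    Good (lft sm, lft sp) ∧ Good (rgt sm, rgt sp) ∧
      hgt 0 (lft sm) N = hgt 0 (rgt sm) N ∧ hgt 2 (lft sp) N = hgt 2 (rgt sp) N := by
  obtain ⟨e1, e2, e3, e4⟩ := hgt_ends sp sm h he
  have A := fun i hi => hgt_lft 1 sp i hi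
  have B := fun i hi => hgt_lft 1 sm i hi
  have C := fun i hi => hgt_rgt 1 sp i hi
  have D := fun i hi => hgt_rgt 1 sm i hi
  rw [e1] at A
  rw [e2] at B
  rw [e3] at C
  rw [e4] at D
  obtain ⟨-, h2, h3, h4, -⟩ := h
  refine ⟨⟨?_, ?_, ?_⟩, ⟨?_, ?_, ?_⟩, ?_, ?_⟩
  · intro i hi; simp only; rw [← B i hi]; exact h4 _ (by omega)
  · intro i hi; simp only; rw [← A i hi]; exact h3 _ (by omega)
  · intro i hi; simp only; rw [← A i hi, ← B i hi]; exact h2 _ (by omega) (by omega)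
  · intro i hi; simp only; rw [← D i hi]; exact h4 _ (by omega)
  · intro i hi; simp only; rw [← C i hi]; exact h3 _ (by omega)
  · intro i hi; simp only; rw [← C i hi, ← D i hi]; exact h2 _ (by omega) (by omega)
  · rw [← B N le_rfl, ← D N le_rfl]; congr 1; omega
  · rw [← A N le_rfl, ← C N le_rfl]; congr 1; omega

lemma glue_hgts {N : ℕ} (b : Bool) (s t : Fin N → Bool) (c : ℤ) (hc : c = if b then 2 else 0)
    (hN : hgt c s N = hgt c t N) :
    (∀ i ≤ N, hgt 1 (glue b s t) (i + 1) = hgt c s i) ∧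
    (∀ i ≤ N, hgt 1 (glue b s t) (2 * N + 1 - i) = hgt c t i) ∧
    hgt 1 (glue b s t) (2 * N + 2) = 1 := by
  have g1 : hgt 1 (glue b s t) 1 = c := by
    have := hgt_succ 1 (glue b s t) 0 (by omega)
    rw [glue_first, hgt_zero] at this
    rw [hc]; cases b <;> simpa using this
  have A : ∀ i ≤ N, hgt 1 (glue b s t) (i + 1) = hgt c s i := by
    intro i hi
    rw [hgt_lft 1 _ i hi, lft_glue, g1]
  have g2 : hgt 1 (glue b s t) (2 * N + 1) = c := by
    have h1 := hgt_rgt 1 (glue b s t) N le_rfl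
    have h2 := A N le_rfl
    have e : 2 * N + 1 - N = N + 1 := by omega
    rw [e, h2, hN, rgt_glue, hgt_base, hgt_base (hgt _ _ _)] at h1
    omega
  refine ⟨A, ?_, ?_⟩
  · intro i hi
    rw [hgt_rgt 1 _ i hi, rgt_glue, g2]
  · have := hgt_succ 1 (glue b s t) (2 * N + 1) (by omega)
    rw [glue_last, g2, hc] at this
    cases b <;> simpa using this

lemma backward {N : ℕ} (p q : (Fin N → Bool) × (Fin N → Bool)) (hp : Good p) (hq : Good q)
    (h1 : hgt 0 p.1 N = hgt 0 q.1 N) (h2 : hgt 2 p.2 N = hgt 2 q.2 N) :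
    IsStaircase 1 (glue true p.2 q.2) (glue false p.1 q.1) ∧
      hgt 1 (glue true p.2 q.2) (2 * N + 2) = 1 := by
  obtain ⟨A, C, E⟩ := glue_hgts true p.2 q.2 2 (by simp) h2
  obtain ⟨B, D, F⟩ := glue_hgts false p.1 q.1 0 (by simp) h1
  have key : ∀ i, 0 < i → i < 2 * N + 2 → (∃ j ≤ N, i = j + 1) ∨ (∃ j ≤ N, i = 2 * N + 1 - j) := by
    intro i h0 hi
    by_cases h : i ≤ N + 1
    · exact Or.inl ⟨i - 1, by omega, by omega⟩
    · exact Or.inr ⟨2 * N + 1 - i, by omega, by omega⟩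
  refine ⟨⟨by rw [E, F], ?_, ?_, ?_, ⟨1, by omega, Or.inr ?_⟩⟩, E⟩
  · intro i h0 hi
    rcases key i h0 hi with ⟨j, hj, rfl⟩ | ⟨j, hj, rfl⟩
    · rw [A j hj, B j hj]; exact hp.2.2 j hj
    · rw [C j hj, D j hj]; exact hq.2.2 j hj
  · intro i hi
    rcases Nat.eq_zero_or_pos i with rfl | h0
    · rw [hgt_zero]; norm_num
    rcases Nat.eq_or_lt_of_le hi with rfl | hi
    · rw [E]; norm_num
    rcases key i h0 hi with ⟨j, hj, rfl⟩ | ⟨j, hj, rfl⟩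
    · rw [A j hj]; exact hp.2.1 j hj
    · rw [C j hj]; exact hq.2.1 j hj
  · intro i hi
    rcases Nat.eq_zero_or_pos i with rfl | h0
    · rw [hgt_zero]; norm_num
    rcases Nat.eq_or_lt_of_le hi with rfl | hi
    · rw [F]; norm_num
    rcases key i h0 hi with ⟨j, hj, rfl⟩ | ⟨j, hj, rfl⟩
    · rw [B j hj]; exact hp.1 j hj
    · rw [D j hj]; exact hq.1 j hj
  · have := B 0 (by omega)
    rwa [hgt_zero] at this

/-- weight of the contact counted twice -/
noncomputable def wt (a : ℝ) (m : ℤ) : ℝ := if m = 0 then 1 / a else 1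

/-- pairs of admissible pairs with matching ends -/
noncomputable def X (N : ℕ) :
    Finset (((Fin N → Bool) × (Fin N → Bool)) × ((Fin N → Bool) × (Fin N → Bool))) :=
  Finset.univ.filter fun x => Good x.1 ∧ Good x.2 ∧
    hgt 0 x.1.1 N = hgt 0 x.2.1 N ∧ hgt 2 x.1.2 N = hgt 2 x.2.2 N

/-- weight of a matching pair -/
noncomputable def F (a y : ℝ) {N : ℕ}
    (x : ((Fin N → Bool) × (Fin N → Bool)) × ((Fin N → Bool) × (Fin N → Bool))) : ℝ :=
  wt a (hgt 0 x.1.1 N) * (a ^ visits 0 x.1.1 * a ^ visits 0 x.2.1) * y ^ hgt 2 x.1.2 N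

lemma PG_eq_X (N : ℕ) (a y : ℝ) (ha : 0 < a) :
    PG (2 * N + 2) a y = ∑ x ∈ X N, F a y x := by
  have hev : (2 * N + 2) % 2 = 0 := by omega
  have hhalf : (2 * N + 2) / 2 = N + 1 := by omega
  unfold PG
  rw [hhalf]
  simp only [hev, if_true]
  refine Finset.sum_bij'
    (fun p _ => ((lft p.2.2, lft p.2.1), (rgt p.2.2, rgt p.2.1)))
    (fun x _ => (⟨1, by omega⟩, glue true x.1.2 x.2.2, glue false x.1.1 x.2.1)) ?_ ?_ ?_ ?_ ?_
  · rintro ⟨c, sp, sm⟩ hp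
    simp only [Finset.mem_filter, Finset.mem_univ, true_and] at hp
    obtain ⟨h1, h2, h3⟩ := hp
    rw [h2] at h1 h3
    simpa [X] using forward sp sm h1 h3
  · rintro ⟨p, q⟩ hx
    simp only [X, Finset.mem_filter, Finset.mem_univ, true_and] at hx
    obtain ⟨h1, h2, h3, h4⟩ := hx
    have := backward p q h1 h2 h3 h4
    simpa using this
  · rintro ⟨c, sp, sm⟩ hp
    simp only [Finset.mem_filter, Finset.mem_univ, true_and] at hp
    obtain ⟨h1, h2, h3⟩ := hp
    rw [h2] at h1 h3
    obtain ⟨f1, f2, f3, f4⟩ := first_last sp sm h1 h3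
    have hc : c = ⟨1, by omega⟩ := by
      apply Fin.ext; simp only; exact_mod_cast h2
    simp only [glue_eq true sp f1 (by simpa using f3), glue_eq false sm f2 (by simpa using f4), hc]
  · rintro ⟨p, q⟩ hx
    simp only [lft_glue, rgt_glue]
  · rintro ⟨c, sp, sm⟩ hp
    simp only [Finset.mem_filter, Finset.mem_univ, true_and] at hp
    obtain ⟨h1, h2, h3⟩ := hp
    simp only [h2] at h1 h3 ⊢
    obtain ⟨e1, e2, e3, e4⟩ := hgt_ends sp sm h1 h3
    have hv := visits_split sm e2 e4 (by rw [← h1.1, h3])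
    simp only [F]
    rw [hgt_lft 1 sp N le_rfl, e1, ← pow_add, ← hv, wt]
    split_ifs
    · rw [pow_succ]; field_simp
    · simp

lemma X_eq (N : ℕ) (a y : ℝ) :
    ∑ x ∈ X N, F a y x = ∑ k ∈ Finset.range (N + 1), ∑ m ∈ Finset.range (k + 1),
      wt a m * (sW a N k m) ^ 2 * y ^ (k + 2) := by
  rw [Finset.sum_sigma']
  rw [← Finset.sum_fiberwise_of_maps_to (s := X N)
    (t := (Finset.range (N + 1)).sigma fun k => Finset.range (k + 1))
    (g := fun x => ⟨(hgt 2 x.1.2 N - 2).toNat, (hgt 0 x.1.1 N).toNat⟩)]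
  · refine Finset.sum_congr rfl ?_
    rintro ⟨k, m⟩ hkm
    simp only
    rw [sW, pow_two, Finset.sum_mul_sum, ← Finset.sum_product', Finset.mul_sum, Finset.sum_mul]
    refine Finset.sum_congr ?_ ?_
    · ext ⟨p, q⟩
      simp only [X, Finset.mem_filter, Finset.mem_univ, true_and, Finset.mem_product,
        Sigma.mk.injEq, heq_eq_eq]
      constructor
      · rintro ⟨⟨h1, h2, h3, h4⟩, h5, h6⟩
        have u1 := h1.1 N le_rfl
        have u2 := h1.2.2 N le_rfl
        have u3 := parity 0 p.1 N le_rfl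
        have u4 := parity 2 p.2 N le_rfl
        refine ⟨⟨h1.1, h1.2.1, h1.2.2, ?_, ?_⟩, h2.1, h2.2.1, h2.2.2, ?_, ?_⟩ <;> omega
      · rintro ⟨⟨h1, h2, h3, h4, h5⟩, h6, h7, h8, h9, h10⟩
        refine ⟨⟨⟨h1, h2, h3⟩, ⟨h6, h7, h8⟩, ?_, ?_⟩, ?_, ?_⟩ <;> omega
    · rintro ⟨p, q⟩ hx
      simp only [Finset.mem_filter, Finset.mem_univ, true_and, Finset.mem_product] at hx
      obtain ⟨⟨h1, h2, h3, h4, h5⟩, h6, h7, h8, h9, h10⟩ := hx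
      simp only [F]
      rw [h4, h5]
      norm_cast
  · rintro ⟨p, q⟩ hx
    simp only [X, Finset.mem_filter, Finset.mem_univ, true_and] at hx
    obtain ⟨h1, h2, h3, h4⟩ := hx
    have u1 := h1.1 N le_rfl
    have u2 := h1.2.2 N le_rfl
    have u3 := parity 0 p.1 N le_rfl
    have u4 := parity 2 p.2 N le_rfl
    have u5 := upper 2 p.2 N le_rfl
    simp only [Finset.mem_sigma, Finset.mem_range]
    constructor <;> omega

end PGaux

/-- For even `n`, the grafted-polygon partition function via pairs of paths. -/
theorem PG_even_eq (n : ℕ) (hn : 2 ≤ n) (hpar : n % 2 = 0) (a y : ℝ)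
    (ha : 0 < a) (hy : 0 < y) :
    PG n a y =
      (1 / a) * ∑ k ∈ Finset.range ((n - 2) / 2 + 1),
          (sW a ((n - 2) / 2) k 0) ^ 2 * y ^ (k + 2)
        + ∑ k ∈ Finset.range ((n - 2) / 2 + 1), ∑ m ∈ Finset.Icc 1 k,
            (sW a ((n - 2) / 2) k m) ^ 2 * y ^ (k + 2) := by
  obtain ⟨N, rfl⟩ : ∃ N, n = 2 * N + 2 := ⟨(n - 2) / 2, by omega⟩
  have e : (2 * N + 2 - 2) / 2 = N := by omega
  rw [e, PGaux.PG_eq_X N a y ha, PGaux.X_eq, Finset.mul_sum, ← Finset.sum_add_distrib]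
  refine Finset.sum_congr rfl fun k _ => ?_
  have hr : Finset.range (k + 1) = insert 0 (Finset.Icc 1 k) := by
    ext m; simp only [Finset.mem_range, Finset.mem_insert, Finset.mem_Icc]; omega
  rw [hr, Finset.sum_insert (by simp)]
  congr 1
  · simp [PGaux.wt, mul_assoc]
  · refine Finset.sum_congr rfl fun m hm => ?_
    have : m ≠ 0 := by simp only [Finset.mem_Icc] at hm; omega
    simp [PGaux.wt, this]
end

section
/- As n → ∞ along integers n ≡ 2 (mod 4), one has P^{G1}_{2n}(2,1) · n^{7/2} · 4^{−n} → 24√2 / π^{3/2}; that is, P^{G1}_{2n}(2,1) is asymptotic to (24√2/π^{3/2}) · 4^n / n^{7/2}. -/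
open Finset Filter

attribute [local instance] Classical.propDecidable

/-- `P^{G1}_{2n}(a,y) = Σ_{k=0}^{(n-2)/2} (s_{(n-2)/2}(k,0))² y^{k+2}` (for even `n`). -/
noncomputable def PG1 (n : ℕ) (a y : ℝ) : ℝ :=
  ∑ k ∈ Finset.range ((n - 2) / 2 + 1), (sW a ((n - 2) / 2) k 0) ^ 2 * y ^ (k + 2)


namespace PG1Aux

def st (b : Bool) : ℤ := if b then 1 else -1

lemma hgt_snoc_le {n : ℕ} (c : ℤ) (s : Fin n → Bool) (b : Bool) (i : ℕ) (hi : i ≤ n) :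
    hgt c (Fin.snoc (α := fun _ => Bool) s b : Fin (n+1) → Bool) i = hgt c s i := by
  unfold hgt
  congr 1
  apply Finset.sum_congr rfl
  intro j hj
  have hj' : j < n := by have := Finset.mem_range.1 hj; omega
  have h2 : j < n + 1 := by omega
  simp only [hj', h2, dif_pos]
  have : (Fin.snoc (α := fun _ => Bool) s b : Fin (n+1) → Bool) ⟨j, h2⟩ = s ⟨j, hj'⟩ := by
    simp [Fin.snoc, hj']
  rw [this]

lemma hgt_snoc_last {n : ℕ} (c : ℤ) (s : Fin n → Bool) (b : Bool) :
    hgt c (Fin.snoc (α := fun _ => Bool) s b : Fin (n+1) → Bool) (n+1) = hgt c s n + st b := by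
  rw [← hgt_snoc_le c s b n le_rfl]
  unfold hgt
  rw [Finset.sum_range_succ, add_assoc]
  congr 2
  simp [Fin.snoc, st]

def good (n : ℕ) (s t : Fin n → Bool) : Prop :=
  InUHP 0 s ∧ InUHP 2 t ∧ (∀ i ≤ n, hgt 0 s i < hgt 2 t i)

lemma forall_le_succ (n : ℕ) (P : ℕ → Prop) :
    (∀ i ≤ n + 1, P i) ↔ (∀ i ≤ n, P i) ∧ P (n+1) := by
  constructor
  · intro h
    exact ⟨fun i hi => h i (by omega), h _ le_rfl⟩
  · rintro ⟨h1, h2⟩ i hi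
    rcases Nat.lt_or_ge i (n+1) with h | h
    · exact h1 i (by omega)
    · have : i = n + 1 := by omega
      rw [this]; exact h2

lemma inUHP_snoc {n : ℕ} (c : ℤ) (s : Fin n → Bool) (b : Bool) :
    InUHP c (Fin.snoc (α := fun _ => Bool) s b : Fin (n+1) → Bool) ↔
      InUHP c s ∧ 0 ≤ hgt c s n + st b := by
  unfold InUHP
  rw [forall_le_succ, hgt_snoc_last]
  apply and_congr_left
  intro _
  apply forall₂_congr
  intro i hi
  rw [hgt_snoc_le _ _ _ _ hi]

lemma good_snoc {n : ℕ} (s t : Fin n → Bool) (b c : Bool) :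
    good (n+1) (Fin.snoc (α := fun _ => Bool) s b) (Fin.snoc (α := fun _ => Bool) t c) ↔
      good n s t ∧ 0 ≤ hgt 0 s n + st b ∧ hgt 0 s n + st b < hgt 2 t n + st c := by
  unfold good
  rw [inUHP_snoc, inUHP_snoc, forall_le_succ, hgt_snoc_last, hgt_snoc_last]
  have : (∀ i ≤ n, hgt 0 (Fin.snoc (α := fun _ => Bool) s b : Fin (n+1) → Bool) i
      < hgt 2 (Fin.snoc (α := fun _ => Bool) t c : Fin (n+1) → Bool) i) ↔
      (∀ i ≤ n, hgt 0 s i < hgt 2 t i) := by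
    apply forall₂_congr
    intro i hi
    rw [hgt_snoc_le _ _ _ _ hi, hgt_snoc_le _ _ _ _ hi]
  rw [this]
  constructor
  · rintro ⟨⟨a, b⟩, ⟨c, d⟩, e, f⟩
    exact ⟨⟨a, c, e⟩, b, f⟩
  · rintro ⟨⟨a, c, e⟩, b, f⟩
    exact ⟨⟨a, b⟩, ⟨c, by omega⟩, e, f⟩

lemma visits_snoc {n : ℕ} (s : Fin n → Bool) (b : Bool) :
    visits 0 (Fin.snoc (α := fun _ => Bool) s b : Fin (n+1) → Bool) =
      visits 0 s + if hgt 0 s n + st b = 0 then 1 else 0 := by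
  unfold visits
  rw [Finset.card_filter, Finset.card_filter, Finset.sum_range_succ, hgt_snoc_last]
  congr 1
  apply Finset.sum_congr rfl
  intro i hi
  rw [hgt_snoc_le _ _ _ _ (by have := Finset.mem_range.1 hi; omega)]

noncomputable def T (n : ℕ) (m h : ℤ) : ℝ :=
  ∑ s : Fin n → Bool, ∑ t : Fin n → Bool,
    if good n s t ∧ hgt 0 s n = m ∧ hgt 2 t n = h then (2:ℝ) ^ visits 0 s else 0

lemma sW_eq (n k : ℕ) : sW 2 n k 0 = T n 0 (k+2) := by
  unfold sW T
  rw [Finset.sum_filter, Fintype.sum_prod_type]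
  apply Finset.sum_congr rfl
  intro s _
  apply Finset.sum_congr rfl
  intro t _
  simp only [good, and_assoc, Nat.cast_zero]

lemma T_zero_of (n : ℕ) (m h : ℤ) (hm : ¬ (0 ≤ m ∧ m < h)) : T n m h = 0 := by
  unfold T
  apply Finset.sum_eq_zero
  intro s _
  apply Finset.sum_eq_zero
  intro t _
  rw [if_neg]
  rintro ⟨⟨h1, h2, h3⟩, h4, h5⟩
  apply hm
  rw [← h4, ← h5]
  exact ⟨h1 n le_rfl, h3 n le_rfl⟩

lemma sum_snoc {n : ℕ} (f : (Fin (n+1) → Bool) → ℝ) :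
    ∑ s, f s = ∑ b : Bool, ∑ s : Fin n → Bool, f (Fin.snoc (α := fun _ => Bool) s b) := by
  rw [← (Fin.snocEquiv (fun _ : Fin (n+1) => Bool)).sum_comp, Fintype.sum_prod_type]
  rfl

lemma T_succ (n : ℕ) (m h : ℤ) (h0 : 0 ≤ m) (h1 : m < h) :
    T (n+1) m h = (if m = 0 then 2 else 1) *
      (T n (m-1) (h-1) + T n (m-1) (h+1) + T n (m+1) (h-1) + T n (m+1) (h+1)) := by
  have key : ∀ b c : Bool, ∑ s : Fin n → Bool, ∑ t : Fin n → Bool,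
      (if good (n+1) (Fin.snoc (α := fun _ => Bool) s b) (Fin.snoc (α := fun _ => Bool) t c) ∧
        hgt 0 (Fin.snoc (α := fun _ => Bool) s b : Fin (n+1) → Bool) (n+1) = m ∧
        hgt 2 (Fin.snoc (α := fun _ => Bool) t c : Fin (n+1) → Bool) (n+1) = h then
        (2:ℝ) ^ visits 0 (Fin.snoc (α := fun _ => Bool) s b : Fin (n+1) → Bool) else 0)
      = (if m = 0 then 2 else 1) * T n (m - st b) (h - st c) := by
    intro b c
    unfold T
    rw [Finset.mul_sum]
    apply Finset.sum_congr rfl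
    intro s _
    rw [Finset.mul_sum]
    apply Finset.sum_congr rfl
    intro t _
    rw [good_snoc, hgt_snoc_last, hgt_snoc_last, visits_snoc]
    by_cases hc : good n s t ∧ hgt 0 s n = m - st b ∧ hgt 2 t n = h - st c
    · obtain ⟨hg, ha, hb⟩ := hc
      have e1 : hgt 0 s n + st b = m := by omega
      have e2 : hgt 2 t n + st c = h := by omega
      rw [e1, e2, if_pos (show (good n s t ∧ 0 ≤ m ∧ m < h) ∧ m = m ∧ h = h from
        ⟨⟨hg, h0, h1⟩, rfl, rfl⟩),
        if_pos (show good n s t ∧ hgt 0 s n = m - st b ∧ hgt 2 t n = h - st c from ⟨hg, ha, hb⟩)]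
      by_cases hm : m = 0
      · simp [hm, pow_succ, mul_comm]
      · simp [hm]
    · rw [if_neg hc, if_neg, mul_zero]
      rintro ⟨⟨hg, _⟩, ha, hb⟩
      exact hc ⟨hg, by omega, by omega⟩
  have : T (n+1) m h = ∑ b : Bool, ∑ c : Bool,
      (if m = 0 then 2 else 1) * T n (m - st b) (h - st c) := by
    rw [show T (n+1) m h = ∑ s : Fin (n+1) → Bool, ∑ t : Fin (n+1) → Bool,
      if good (n+1) s t ∧ hgt 0 s (n+1) = m ∧ hgt 2 t (n+1) = h then (2:ℝ) ^ visits 0 s else 0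
      from rfl]
    rw [sum_snoc]
    apply Finset.sum_congr rfl
    intro b _
    rw [← Finset.sum_congr rfl (fun c _ => key b c)]
    conv_rhs => rw [Finset.sum_comm]
    apply Finset.sum_congr rfl
    intro s _
    rw [sum_snoc]
  rw [this]
  simp only [Fintype.sum_bool, st, if_true, Bool.false_eq_true, if_false, sub_neg_eq_add]
  ring

/-- number of free walks -/
noncomputable def p : ℕ → ℤ → ℝ
  | 0, d => if d = 0 then 1 else 0
  | n+1, d => p n (d-1) + p n (d+1)

lemma p_neg (n : ℕ) (d : ℤ) : p n (-d) = p n d := by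
  induction n generalizing d with
  | zero => simp [p]
  | succ n ih =>
    simp only [p]
    rw [show -d - 1 = -(d+1) by ring, show -d + 1 = -(d-1) by ring, ih, ih, add_comm]

lemma p_odd (n : ℕ) (d : ℤ) (h : Odd (n + d)) : p n d = 0 := by
  induction n generalizing d with
  | zero =>
    simp only [p]
    rw [if_neg]
    rintro rfl
    simp at h
  | succ n ih =>
    simp only [p]
    push_cast at h
    obtain ⟨k, hk⟩ := h
    rw [ih _ ⟨k-1, by omega⟩, ih _ ⟨k, by omega⟩, add_zero]

lemma p_supp (n : ℕ) (d : ℤ) (h : (n:ℤ) < |d|) : p n d = 0 := by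
  induction n generalizing d with
  | zero =>
    simp only [p]
    rw [if_neg]
    rintro rfl
    simp at h
  | succ n ih =>
    simp only [p]
    push_cast at h
    rw [ih, ih, add_zero]
    · rw [lt_abs] at *; omega
    · rw [lt_abs] at *; omega

lemma p_choose (n i : ℕ) : p n (2*i - n) = n.choose i := by
  induction n generalizing i with
  | zero =>
    simp only [p]
    cases i with
    | zero => simp
    | succ i => rw [if_neg (by push_cast; omega)]; simp
  | succ n ih =>
    simp only [p]
    cases i with
    | zero =>
      rw [p_supp n _ (by rw [lt_abs]; push_cast; omega)]
      have := ih 0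
      rw [show 2 * ((0:ℕ):ℤ) - ((n+1 : ℕ) : ℤ) + 1 = 2 * ((0:ℕ):ℤ) - n by push_cast; ring, this]
      simp
    | succ i =>
      have h1 := ih i
      have h2 := ih (i+1)
      rw [Nat.choose_succ_succ]
      push_cast at *
      rw [show 2 * ((i:ℤ) + 1) - (n + 1) - 1 = 2 * i - n by ring,
        show 2 * ((i:ℤ) + 1) - (n + 1) + 1 = 2 * (i+1) - n by ring, h1, h2]

noncomputable def W (n : ℕ) (x y : ℤ) : ℝ := p n (y - x) + p n (y + x)

lemma W_succ (n : ℕ) (x y : ℤ) : W (n+1) x y = W n x (y-1) + W n x (y+1) := by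
  simp only [W, p]
  rw [show y - x - 1 = y - 1 - x by ring, show y - x + 1 = y + 1 - x by ring,
    show y + x - 1 = y - 1 + x by ring, show y + x + 1 = y + 1 + x by ring]
  ring

lemma W_neg (n : ℕ) (x y : ℤ) : W n x (-y) = W n x y := by
  simp only [W]
  rw [show -y - x = -(y+x) by ring, show -y + x = -(y - x) by ring, p_neg, p_neg, add_comm]

lemma W_odd (n : ℕ) (x y : ℤ) (h : Odd (n + x + y)) : W n x y = 0 := by
  simp only [W]
  obtain ⟨k, hk⟩ := h
  rw [p_odd n _ ⟨k - x, by omega⟩, p_odd n _ ⟨k, by omega⟩, add_zero]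

noncomputable def D (n : ℕ) (m h : ℤ) : ℝ := W n 0 m * W n 2 h - W n 0 h * W n 2 m

lemma D_adj (n : ℕ) (m : ℤ) : D n m (m+1) = 0 := by
  unfold D
  rcases Int.even_or_odd (n + m) with ⟨k, hk⟩ | ⟨k, hk⟩
  · rw [W_odd n 2 (m+1) ⟨k+1, by omega⟩, W_odd n 0 (m+1) ⟨k, by omega⟩]; ring
  · rw [W_odd n 2 m ⟨k+1, by omega⟩, W_odd n 0 m ⟨k, by omega⟩]; ring

lemma D_anti (n : ℕ) (m h : ℤ) : D n h m = - D n m h := by unfold D; ring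

lemma D_succ (n : ℕ) (m h : ℤ) : D (n+1) m h =
    D n (m-1) (h-1) + D n (m-1) (h+1) + D n (m+1) (h-1) + D n (m+1) (h+1) := by
  unfold D
  simp only [W_succ]
  ring

lemma D_neg (n : ℕ) (m h : ℤ) : D n (-m) h = D n m h := by
  unfold D; rw [W_neg, W_neg]

lemma T_eq_D (n : ℕ) (m h : ℤ) (h0 : 0 ≤ m) (h1 : m < h) : T n m h = D n m h := by
  induction n generalizing m h with
  | zero =>
    have hh : h ≠ 0 := by omega
    have hh2 : h + 2 ≠ 0 := by omega
    simp only [T, D, W, p]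
    rw [Fintype.sum_unique, Fintype.sum_unique]
    have hg : ∀ s t : Fin 0 → Bool, good 0 s t := by
      intro s t
      refine ⟨?_, ?_, ?_⟩ <;> intro i hi <;> (have : i = 0 := by omega) <;> subst this <;>
        simp [hgt]
    have hv : ∀ s : Fin 0 → Bool, visits 0 s = 1 := by
      intro s
      simp [visits, hgt]
    rw [hv]
    simp only [hg, true_and, hh, hh2]
    by_cases ha : m = 0
    · by_cases hb : h = 2
      · subst ha hb; norm_num [hgt]
      · have : h - 2 ≠ 0 := by omega
        have hb' : 2 ≠ h := fun h => hb h.symm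
        subst ha; simp [hgt, hb, this, hb', hh]
    · have ha' : 0 ≠ m := fun h => ha h.symm
      simp [hgt, ha, ha', hh]
  | succ n ih =>
    rw [T_succ n m h h0 h1, D_succ]
    have e4 := ih (m+1) (h+1) (by omega) (by omega)
    have e3 : T n (m+1) (h-1) = D n (m+1) (h-1) := by
      by_cases hc : m + 1 < h - 1
      · exact ih _ _ (by omega) hc
      · rw [T_zero_of _ _ _ (by omega)]
        have : h = m + 1 ∨ h = m + 2 := by omega
        rcases this with rfl | rfl
        · rw [show m + 1 - 1 = m by ring, D_anti, D_adj, neg_zero]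
        · rw [show m + 2 - 1 = m + 1 by ring]; unfold D; ring
    rw [e3, e4]
    by_cases hm : m = 0
    · subst hm
      rw [T_zero_of n (0-1) (h-1) (by omega), T_zero_of n (0-1) (h+1) (by omega)]
      rw [show (0:ℤ) - 1 = -(0+1) by ring, D_neg, D_neg]
      simp; ring
    · rw [ih (m-1) (h-1) (by omega) (by omega), ih (m-1) (h+1) (by omega) (by omega)]
      simp [hm]

lemma p_summ (n : ℕ) (g : ℤ → ℝ) : Summable (fun d => p n d * g d) := by
  apply summable_of_ne_finset_zero (s := Finset.Icc (-(n:ℤ)) n)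
  intro d hd
  rw [p_supp, zero_mul]
  rw [lt_abs]
  simp only [Finset.mem_Icc, not_and, not_le] at hd
  by_contra hc
  push Not at hc
  have := hd (by omega)
  omega

lemma tsum_shift (f : ℤ → ℝ) (a : ℤ) : ∑' d, f (d + a) = ∑' d, f d :=
  (Equiv.addRight a).tsum_eq f

lemma p_conv (n m : ℕ) (t : ℤ) : ∑' d, p n d * p m (t - d) = p (n+m) t := by
  induction n generalizing m t with
  | zero =>
    rw [tsum_eq_single 0]
    · simp [p]
    · intro d hd; simp [p, hd]
  | succ n ih =>
    have e1 : ∑' d, p n (d-1) * p m (t - d) = ∑' d, p n d * p m (t - d - 1) := by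
      rw [← tsum_shift (fun d => p n (d-1) * p m (t-d)) 1]
      congr 1; ext d
      rw [show d + 1 - 1 = d by ring, show t - (d+1) = t - d - 1 by ring]
    have e2 : ∑' d, p n (d+1) * p m (t - d) = ∑' d, p n d * p m (t - d + 1) := by
      rw [← tsum_shift (fun d => p n d * p m (t-d+1)) 1]
      congr 1; ext d
      rw [show t - (d+1) + 1 = t - d by ring]
    have s1 : Summable (fun d => p n (d-1) * p m (t - d)) := by
      have := (Equiv.addRight (-1:ℤ)).summable_iff.2 (p_summ n (fun d => p m (t - d - 1)))
      convert this using 1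
      ext d
      simp only [Function.comp, Equiv.coe_addRight]
      rw [show d + -1 = d - 1 by ring, show t - (d-1) - 1 = t - d by ring]
    have s2 : Summable (fun d => p n (d+1) * p m (t - d)) := by
      have := (Equiv.addRight (1:ℤ)).summable_iff.2 (p_summ n (fun d => p m (t - d + 1)))
      convert this using 1
      ext d
      simp only [Function.comp, Equiv.coe_addRight]
      rw [show t - (d+1) + 1 = t - d by ring]
    have : ∑' d, p (n+1) d * p m (t - d)
        = ∑' d, (p n (d-1) * p m (t - d) + p n (d+1) * p m (t - d)) := by
      congr 1; ext d; simp only [p]; ring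
    rw [this, s1.tsum_add s2, e1, e2, ← (p_summ n _).tsum_add (p_summ n _)]
    rw [show n + 1 + m = n + (m+1) by ring, ← ih]
    congr 1; ext d; simp only [p]; ring

lemma p_corr (n : ℕ) (a b : ℤ) :
    HasSum (fun d => p n (d+a) * p n (d+b)) (p (n+n) (a-b)) := by
  have h : HasSum (fun d => p n d * p n ((a - b) - d)) (p (n+n) (a-b)) := by
    rw [← p_conv]; exact (p_summ n _).hasSum
  have := (Equiv.addRight a).hasSum_iff.2 h
  convert this using 1
  ext d
  simp only [Function.comp, Equiv.coe_addRight]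
  rw [← p_neg n (d + b)]
  congr 2; ring

noncomputable def e (n : ℕ) (r : ℝ) (d : ℤ) : ℝ := p n (d-2) + p n (d+2) - 2 * r * p n d

lemma e_sq (n : ℕ) (r : ℝ) : HasSum (fun d => e n r d ^ 2)
    (2 * p (n+n) 0 + 2 * p (n+n) 4 + 4 * r^2 * p (n+n) 0 - 8 * r * p (n+n) 2) := by
  have h1 := p_corr n (-2) (-2)
  have h2 := p_corr n 2 2
  have h3 := (p_corr n 0 0).mul_left (4 * r^2)
  have h4 := (p_corr n 2 (-2)).mul_left 2
  have h5 := (p_corr n 0 (-2)).mul_left (-4*r)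
  have h6 := (p_corr n 2 0).mul_left (-4*r)
  have := ((((h1.add h2).add h3).add h4).add h5).add h6
  convert this using 1
  · ext d
    simp only [e, add_zero]
    rw [show d + -2 = d - 2 by ring]
    ring
  · norm_num
    ring

lemma e_half (N : ℕ) (hN : Even N) (r : ℝ) (hr : p N 2 = r * p N 0) :
    2 * ∑ k ∈ Finset.range (N+1), e N r (k+2) ^ 2 =
    2 * p (N+N) 0 + 2 * p (N+N) 4 + 4 * r^2 * p (N+N) 0 - 8 * r * p (N+N) 2 := by
  have h0 : e N r 0 = 0 := by
    simp only [e]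
    rw [show (0:ℤ) - 2 = -2 by ring, show (0:ℤ) + 2 = 2 by ring, p_neg, hr]; ring
  have h1 : e N r 1 = 0 := by
    obtain ⟨q, hq⟩ := hN
    simp only [e]
    rw [p_odd N _ ⟨q - 1, by push_cast [hq]; ring⟩, p_odd N _ ⟨q + 1, by push_cast [hq]; ring⟩,
      p_odd N _ ⟨q, by push_cast [hq]; ring⟩]; ring
  have hneg : ∀ d, e N r (-d) = e N r d := by
    intro d
    simp only [e]
    rw [show -d - 2 = -(d+2) by ring, show -d+2 = -(d-2) by ring, p_neg, p_neg, p_neg]; ring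
  have hs : HasSum (fun k : ℕ => e N r k ^ 2) (∑ k ∈ Finset.range (N+3), e N r k ^ 2) := by
    apply hasSum_sum_of_ne_finset_zero
    intro k hk
    have hk' : N + 3 ≤ k := by simpa using hk
    simp only [e]
    rw [p_supp, p_supp, p_supp]
    · ring
    all_goals rw [lt_abs]; left; omega
  have hz := HasSum.of_nat_of_neg (f := fun d : ℤ => e N r d ^ 2) hs (by simpa only [hneg] using hs)
  have := hz.unique (e_sq N r)
  rw [← this, Finset.sum_range_succ' _ (N+2), Finset.sum_range_succ' _ (N+1)]
  push_cast
  simp only [h0, zero_add, h1]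
  have : ∀ k : ℕ, ((k:ℤ) + 1 + 1) = k + 2 := fun k => by ring
  simp only [this]
  ring

lemma p_even (j t : ℕ) : p (2*j) (2*t) = (2*j).choose (j+t) := by
  rw [← p_choose]; congr 1; push_cast; ring

lemma PG1_closed (j : ℕ) : PG1 (4*j+2) 2 1 =
    4 * (Nat.centralBinom j : ℝ)^2 * Nat.centralBinom (2*j) * (3*j+1) / ((j+1)^2 * (2*j+1)) := by
  have hj : (4*j+2-2)/2 = 2*j := by omega
  have hp0 : p (2*j) 0 = Nat.centralBinom j := by
    have := p_even j 0; simpa [Nat.centralBinom] using this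
  have hp2 : p (2*j) 2 = ((j:ℝ)/(j+1)) * p (2*j) 0 := by
    have h := p_even j 1
    have h3 := Nat.choose_succ_right_eq (2*j) j
    rw [show 2*j - j = j by omega] at h3
    have h4 : ((2*j).choose (j+1) : ℝ) * (j+1) = (2*j).choose j * j := by exact_mod_cast h3
    simp only [Nat.cast_one, mul_one] at h
    rw [h, hp0, Nat.centralBinom]
    field_simp
    linarith
  have hs : ∀ k : ℕ, sW 2 (2*j) k 0 = 2 * p (2*j) 0 * e (2*j) ((j:ℝ)/(j+1)) (k+2) := by
    intro k
    rw [sW_eq, T_eq_D _ _ _ le_rfl (by omega)]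
    simp only [D, W, e]
    rw [show (0:ℤ) - 2 = -2 by ring, p_neg]
    simp only [sub_zero, add_zero, zero_add]
    rw [hp2]; ring
  have hsum := e_half (2*j) ⟨j, by ring⟩ _ hp2
  have hP : PG1 (4*j+2) 2 1 = 2 * p (2*j) 0 ^ 2 *
      (2 * ∑ k ∈ Finset.range (2*j+1), e (2*j) ((j:ℝ)/(j+1)) (k+2) ^ 2) := by
    unfold PG1
    rw [hj, Finset.mul_sum, Finset.mul_sum]
    apply Finset.sum_congr rfl
    intro k _
    rw [hs]; ring
  have h2j : 2*j + 2*j = 2*(2*j) := by ring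
  have b0 : p (2*(2*j)) 0 = Nat.centralBinom (2*j) := by
    have := p_even (2*j) 0; simpa [Nat.centralBinom] using this
  have c1 := Nat.choose_succ_right_eq (2*(2*j)) (2*j)
  have c2 := Nat.choose_succ_right_eq (2*(2*j)) (2*j+1)
  rw [show 2*(2*j) - 2*j = 2*j by omega] at c1
  have c1' : ((2*(2*j)).choose (2*j+1) : ℝ) * (2*j+1) = Nat.centralBinom (2*j) * (2*j) := by
    exact_mod_cast c1
  have c2' : ((2*(2*j)).choose (2*j+2) : ℝ) * (2*j+2) =
      (2*(2*j)).choose (2*j+1) * (2*j - 1) := by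
    rcases Nat.eq_zero_or_pos j with rfl | hpos
    · simp
    · rw [show (2*(j:ℝ) - 1) = ((2*(2*j) - (2*j+1) : ℕ) : ℝ) by
        rw [show 2*(2*j) - (2*j+1) = 2*j-1 by omega, Nat.cast_sub (by omega)]; push_cast; ring]
      exact_mod_cast c2
  have b1 : p (2*(2*j)) 2 = Nat.centralBinom (2*j) * (2*j) / (2*j+1) := by
    have := p_even (2*j) 1
    simp only [Nat.cast_one, mul_one] at this
    rw [this, ← c1']; field_simp
  have b2 : p (2*(2*j)) 4 = Nat.centralBinom (2*j) * (2*j) * (2*j-1) / ((2*j+1) * (2*j+2)) := by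
    have := p_even (2*j) 2
    norm_num at this
    rw [this, ← c1', eq_div_iff (by positivity)]
    linear_combination (2*(j:ℝ)+1) * c2'
  rw [hP, hsum, h2j, b0, b1, b2, hp0]
  field_simp
  ring

lemma cb_tendsto : Tendsto (fun j : ℕ => (Nat.centralBinom j : ℝ) * √j / 4^j) atTop
    (nhds (1/√Real.pi)) := by
  have h1 := Stirling.tendsto_stirlingSeq_sqrt_pi
  have h2 : Tendsto (fun j : ℕ => Stirling.stirlingSeq (2*j)) atTop (nhds (√Real.pi)) :=
    h1.comp (tendsto_id.const_mul_atTop' (by norm_num))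
  have hpi : √Real.pi ≠ 0 := by positivity
  have h3 := h2.div (h1.pow 2) (by positivity)
  have : √Real.pi / √Real.pi ^ 2 = 1 / √Real.pi := by field_simp
  rw [this] at h3
  refine h3.congr' ?_
  filter_upwards [eventually_gt_atTop 0] with j hj
  have hjr : (0:ℝ) < j := by exact_mod_cast hj
  have hc : (Nat.centralBinom j : ℝ) = (2*j).factorial / (j.factorial)^2 := by
    rw [Nat.centralBinom, Nat.cast_choose ℝ (by omega), show 2*j - j = j by omega, sq]
  simp only [Pi.div_apply, Stirling.stirlingSeq]
  rw [hc]
  have s1 : √(2 * ((2*j:ℕ):ℝ)) = 2 * √j := by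
    push_cast
    rw [show 2 * (2 * (j:ℝ)) = 2^2 * j by ring, Real.sqrt_mul (by norm_num),
      Real.sqrt_sq (by norm_num)]
  have s2 : √(2 * (j:ℝ)) ^ 2 = 2 * j := Real.sq_sqrt (by positivity)
  have s3 : √(j:ℝ) ^ 2 = j := Real.sq_sqrt (by positivity)
  have s4 : (((2*j:ℕ):ℝ) / Real.exp 1) ^ (2*j) = 4^j * (((j:ℝ) / Real.exp 1) ^ j)^2 := by
    rw [← pow_mul, mul_comm j 2, pow_mul, pow_mul, ← mul_pow]
    congr 1; push_cast; ring
  rw [s1, s4]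
  have hf : (j.factorial : ℝ) ≠ 0 := by positivity
  have he : ((j:ℝ) / Real.exp 1) ^ j ≠ 0 := by positivity
  have hsj : √(j:ℝ) ≠ 0 := by positivity
  generalize ((j:ℝ) / Real.exp 1) ^ j = E at *
  rw [div_pow, mul_pow, s2]
  field_simp
  rw [s3]

lemma main_tendsto : Tendsto (fun j : ℕ =>
        PG1 (4 * j + 2) 2 1 * ((4 * j + 2 : ℕ) : ℝ) ^ ((7 : ℝ) / 2)
          / (4 : ℝ) ^ (4 * j + 2))
      atTop (nhds (24 * Real.sqrt 2 / Real.pi ^ ((3 : ℝ) / 2))) := by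
  have h1 := cb_tendsto
  have h2 : Tendsto (fun j : ℕ => (Nat.centralBinom (2*j) : ℝ) * √((2*j:ℕ):ℝ) / 4^(2*j)) atTop
    (nhds (1/√Real.pi)) := cb_tendsto.comp (tendsto_id.const_mul_atTop' (by norm_num))
  have hu : Tendsto (fun j : ℕ => 1 / (j:ℝ)) atTop (nhds 0) := tendsto_one_div_atTop_nhds_zero_nat
  have h3 : Tendsto (fun j : ℕ => (fun u : ℝ => √(2+u) * ((2+u)^2*(3+u)/(2*(1+u)^2))) (1/(j:ℝ)))
      atTop (nhds ((fun u : ℝ => √(2+u) * ((2+u)^2*(3+u)/(2*(1+u)^2))) 0)) := by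
    have hcont : ContinuousAt (fun u : ℝ => √(2+u) * ((2+u)^2*(3+u)/(2*(1+u)^2))) 0 :=
      ContinuousAt.mul (by fun_prop) (ContinuousAt.div (by fun_prop) (by fun_prop) (by norm_num))
    exact hcont.tendsto.comp hu
  have h4 := (((h1.pow 2).mul h2).mul h3).const_mul 4
  have hlim : 4 * ((1 / √Real.pi) ^ 2 * (1 / √Real.pi) *
      (fun u : ℝ => √(2+u) * ((2+u)^2*(3+u)/(2*(1+u)^2))) 0) =
      24 * Real.sqrt 2 / Real.pi ^ ((3 : ℝ) / 2) := by
    have : Real.pi ^ ((3 : ℝ) / 2) = √Real.pi ^ 3 := by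
      rw [Real.sqrt_eq_rpow, ← Real.rpow_natCast, ← Real.rpow_mul Real.pi_pos.le]; norm_num
    rw [this]
    have hpi : √Real.pi ≠ 0 := by positivity
    norm_num
    field_simp
    norm_num
  rw [hlim] at h4
  refine h4.congr' ?_
  filter_upwards [eventually_gt_atTop 0] with j hj
  have hjr : (0:ℝ) < j := by exact_mod_cast hj
  rw [PG1_closed]
  have q1 : ((4 * j + 2 : ℕ) : ℝ) ^ ((7 : ℝ) / 2) = (4*j+2)^3 * (√(2 * (j:ℝ)) * √(2+1/(j:ℝ))) := by
    rw [← Real.sqrt_mul (by positivity), show 2 * (j:ℝ) * (2 + 1/j) = 4*j+2 by field_simp; ring,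
      Real.sqrt_eq_rpow, ← Real.rpow_natCast, ← Real.rpow_add (by positivity)]
    push_cast; norm_num
  rw [q1]
  have s3 : √(j:ℝ) ^ 2 = j := Real.sq_sqrt (by positivity)
  have q2 : (4:ℝ)^(4*j+2) = 16 * ((4^j)^2 * 4^(2*j)) := by
    rw [← pow_mul, ← pow_add, show 4*j+2 = j*2+2*j+2 by ring, pow_add]; norm_num; ring
  rw [q2, div_pow, mul_pow, s3]
  push_cast
  generalize √(2 + 1 / (j:ℝ)) = A
  generalize √(2 * (j:ℝ)) = B
  have : (4:ℝ)^j ≠ 0 := by positivity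
  have : (4:ℝ)^(2*j) ≠ 0 := by positivity
  generalize (4:ℝ)^(2*j) = F at *
  generalize (4:ℝ)^j = G at *
  field_simp
  ring

end PG1Aux

/-- Asymptotics of `P^{G1}_{2n}(2,1)` along `n ≡ 2 (mod 4)`. -/
theorem PG1_asymp_a2_y1 :
    Tendsto (fun j : ℕ =>
        PG1 (4 * j + 2) 2 1 * ((4 * j + 2 : ℕ) : ℝ) ^ ((7 : ℝ) / 2)
          / (4 : ℝ) ^ (4 * j + 2))
      atTop (nhds (24 * Real.sqrt 2 / Real.pi ^ ((3 : ℝ) / 2))) := by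
  exact PG1Aux.main_tendsto
end
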